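/- arXiv:2603.05635 — 3 statements merged into one kernel-verified Lean document; each statement's English description precedes it below -/
import Mathlib

section
/- Let k be a commutative unital ring, let n ≥ 2 and m ≥ 1, and let A be a k-algebra such that (st_{2(n−1)}(x₁,…,x_{2n−2}))^m is a polynomial identity of A. Let a₁, …, a_t ∈ A be elements such that every product of at most n−1 factors taken from {a₁,…,a_t} (repetitions allowed, in any order) is integral over k. Then the k-subalgebra of A generated by a₁, …, a_t is finitely generated as a k-module. -/
/-- `p` is a polynomial identity of the `k`-algebra `A`: every `k`-algebra
homomorphism from the free associative algebra on countably many variables to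
`A` (equivalently, every substitution of elements of `A` for the variables)
sends `p` to `0`. -/
def IsPolyId (k A : Type*) [CommRing k] [Semiring A] [Algebra k A]
    (p : FreeAlgebra k ℕ) : Prop :=
  ∀ f : ℕ → A, FreeAlgebra.lift k f p = 0

/-- `[x₁,x₂]^m`, the `m`-th power of the commutator of the first two variables
of the free algebra. -/
noncomputable def commPow (k : Type*) [CommRing k] (m : ℕ) : FreeAlgebra k ℕ :=
  (FreeAlgebra.ι k 0 * FreeAlgebra.ι k 1 - FreeAlgebra.ι k 1 * FreeAlgebra.ι k 0) ^ m

/-- `[x₁,x₂][x₃,x₄]⋯[x₂ₘ₋₁,x₂ₘ]`, the product of `m` commutators in `2m`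
distinct variables of the free algebra. -/
noncomputable def commProd (k : Type*) [CommRing k] (m : ℕ) : FreeAlgebra k ℕ :=
  ((List.range m).map (fun i =>
    FreeAlgebra.ι k (2 * i) * FreeAlgebra.ι k (2 * i + 1)
      - FreeAlgebra.ι k (2 * i + 1) * FreeAlgebra.ι k (2 * i))).prod

/-- The standard polynomial `st_d(x₁,…,x_d) = Σ_{σ ∈ S_d} sgn(σ) x_{σ(1)}⋯x_{σ(d)}`
in the free algebra. -/
noncomputable def stPoly (k : Type*) [CommRing k] (d : ℕ) : FreeAlgebra k ℕ :=
  ∑ σ : Equiv.Perm (Fin d),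
    (Equiv.Perm.sign σ : ℤ) •
      ((List.finRange d).map (fun i => FreeAlgebra.ι k ((σ i : Fin d) : ℕ))).prod

/-- `A` satisfies a proper (monic multilinear) polynomial identity: for some
`n ≥ 1` there are coefficients `c σ ∈ k` for the non-identity permutations `σ`
of `{1,…,n}` such that `x₁⋯x_n + Σ_{σ ≠ id} c_σ x_{σ(1)}⋯x_{σ(n)}` is a
polynomial identity of `A`. -/
def SatisfiesProperId (k A : Type*) [CommRing k] [Semiring A] [Algebra k A] : Prop :=
  ∃ n : ℕ, 1 ≤ n ∧ ∃ c : Equiv.Perm (Fin n) → k,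
    IsPolyId k A
      (((List.finRange n).map (fun i => FreeAlgebra.ι k (i : ℕ))).prod
        + ∑ σ ∈ Finset.univ.erase (1 : Equiv.Perm (Fin n)),
            c σ • ((List.finRange n).map (fun i => FreeAlgebra.ι k ((σ i : Fin n) : ℕ))).prod)

/-- `a` is strongly nilpotent: every sequence `s` with `s 0 = a` and
`s (n+1) ∈ s n • A • s n` is eventually zero. -/
def IsStronglyNilpotent {A : Type*} [Ring A] (a : A) : Prop :=
  ∀ s : ℕ → A, s 0 = a → (∀ n, ∃ x : A, s (n + 1) = s n * x * s n) →
    ∃ N, ∀ n ≥ N, s n = 0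

namespace ShortProd

section Core

variable {k R : Type*} [CommRing k] [Ring R] [Algebra k R]

/-- A submodule stable under multiplication by the elements of `S` on both sides. -/
structure SId (S : Submonoid R) (P : Submodule k R) : Prop where
  left : ∀ s ∈ S, ∀ x ∈ P, s * x ∈ P
  right : ∀ s ∈ S, ∀ x ∈ P, x * s ∈ P

/-- There are products of the `c j` of any length outside `P`. -/
def NonNil {κ : Type*} (c : κ → R) (P : Submodule k R) : Prop :=
  ∀ D : ℕ, ∃ l : List κ, l.length = D ∧ (l.map c).prod ∉ P

/-- The `S`-ideal generated by `P` and `f`. -/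
def ext (S : Submonoid R) (P : Submodule k R) (f : R) : Submodule k R :=
  P ⊔ Submodule.span k {x | ∃ s ∈ S, ∃ s' ∈ S, x = s * f * s'}

lemma prod_mem_S {κ : Type*} {S : Submonoid R} {c : κ → R} (hc : ∀ j, c j ∈ S) (l : List κ) :
    (l.map c).prod ∈ S := by
  apply Submonoid.list_prod_mem
  intro x hx
  obtain ⟨j, _, rfl⟩ := List.mem_map.1 hx
  exact hc j

lemma ext_sId {S : Submonoid R} {P : Submodule k R} (hP : SId S P) (f : R) :
    SId S (ext S P f) := by
  constructor
  · intro s hs x hx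
    obtain ⟨y, hy, z, hz, rfl⟩ := Submodule.mem_sup.1 hx
    rw [mul_add]
    refine Submodule.add_mem_sup (hP.left s hs y hy) ?_
    clear hx
    induction hz using Submodule.span_induction with
    | mem x h =>
      obtain ⟨a, ha, b, hb, rfl⟩ := h
      exact Submodule.subset_span ⟨s * a, S.mul_mem hs ha, b, hb, by simp only [mul_assoc]⟩
    | zero => simp
    | add x y _ _ h1 h2 => rw [mul_add]; exact Submodule.add_mem _ h1 h2
    | smul r x _ h => rw [mul_smul_comm]; exact Submodule.smul_mem _ _ h
  · intro s hs x hx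
    obtain ⟨y, hy, z, hz, rfl⟩ := Submodule.mem_sup.1 hx
    rw [add_mul]
    refine Submodule.add_mem_sup (hP.right s hs y hy) ?_
    clear hx
    induction hz using Submodule.span_induction with
    | mem x h =>
      obtain ⟨a, ha, b, hb, rfl⟩ := h
      exact Submodule.subset_span ⟨a, ha, b * s, S.mul_mem hb hs, by simp only [mul_assoc]⟩
    | zero => simp
    | add x y _ _ h1 h2 => rw [add_mul]; exact Submodule.add_mem _ h1 h2
    | smul r x _ h => rw [smul_mul_assoc]; exact Submodule.smul_mem _ _ h

lemma exists_max {κ : Type*} [Finite κ] (S : Submonoid R) (c : κ → R)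
    (P0 : Submodule k R) (hP0 : SId S P0) (h0 : NonNil c P0) :
    ∃ P : Submodule k R, P0 ≤ P ∧ SId S P ∧ NonNil c P ∧
      ∀ f, f ∉ P → ∃ D, ∀ l : List κ, l.length = D → (l.map c).prod ∈ ext S P f := by
  obtain ⟨P, hle, hmax⟩ := zorn_le_nonempty₀ {P : Submodule k R | SId S P ∧ NonNil c P} (by
    intro C hC hch Q hQ
    have hdir : DirectedOn (· ≤ ·) C := hch.directedOn
    have hne : C.Nonempty := ⟨Q, hQ⟩
    refine ⟨sSup C, ⟨⟨?_, ?_⟩, ?_⟩, fun z hz => le_sSup hz⟩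
    · intro s hs x hx
      rw [Submodule.mem_sSup_of_directed hne hdir] at hx ⊢
      obtain ⟨y, hy, hxy⟩ := hx
      exact ⟨y, hy, (hC hy).1.left s hs x hxy⟩
    · intro s hs x hx
      rw [Submodule.mem_sSup_of_directed hne hdir] at hx ⊢
      obtain ⟨y, hy, hxy⟩ := hx
      exact ⟨y, hy, (hC hy).1.right s hs x hxy⟩
    · intro D
      by_contra hcon
      push Not at hcon
      have key : ∀ T : Finset (List κ), (∀ l ∈ T, l.length = D) →
          ∃ P ∈ C, ∀ l ∈ T, (l.map c).prod ∈ P := by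
        classical
        intro T
        induction T using Finset.induction_on with
        | empty => intro _; exact ⟨Q, hQ, by simp⟩
        | insert a T _ ih =>
          intro h
          obtain ⟨P1, hP1, h1⟩ := ih (fun l hl => h l (Finset.mem_insert_of_mem hl))
          have := hcon a (h a (Finset.mem_insert_self _ _))
          rw [Submodule.mem_sSup_of_directed hne hdir] at this
          obtain ⟨P2, hP2, h2⟩ := this
          obtain ⟨P3, hP3, h13, h23⟩ := hdir P1 hP1 P2 hP2
          refine ⟨P3, hP3, fun l hl => ?_⟩
          rcases Finset.mem_insert.1 hl with rfl | hl
          · exact h23 h2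
          · exact h13 (h1 l hl)
      obtain ⟨P, hPC, hP⟩ := key (List.finite_length_eq κ D).toFinset (by simp)
      obtain ⟨l, hl, hl'⟩ := (hC hPC).2 D
      exact hl' (hP l (by simpa using hl))) P0 ⟨hP0, h0⟩
  refine ⟨P, hle, hmax.prop.1, hmax.prop.2, fun f hf => ?_⟩
  by_contra hcon
  push Not at hcon
  have h1 : P ≤ ext S P f := le_sup_left
  have h2 := hmax.le_of_ge (y := ext S P f) ⟨ext_sId hmax.prop.1 f, fun D => hcon D⟩ h1
  apply hf
  apply h2
  exact Submodule.mem_sup_right (Submodule.subset_span ⟨1, S.one_mem, 1, S.one_mem, by simp⟩)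

lemma exists_mul_notMem {κ : Type*} {S : Submonoid R} {c : κ → R}
    {P : Submodule k R} (hP : SId S P) (hn : NonNil c P)
    (hmax : ∀ f, f ∉ P → ∃ D, ∀ l : List κ, l.length = D → (l.map c).prod ∈ ext S P f)
    (hc : ∀ j, c j ∈ S)
    {f g : R} (hfS : f ∈ S) (hf : f ∉ P) (hg : g ∉ P) : ∃ s ∈ S, f * s * g ∉ P := by
  by_contra hcon
  push Not at hcon
  obtain ⟨D1, h1⟩ := hmax f hf
  obtain ⟨D2, h2⟩ := hmax g hg
  obtain ⟨l, hl, hlP⟩ := hn (D1 + D2)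
  apply hlP
  rw [← List.take_append_drop D1 l, List.map_append, List.prod_append]
  have ha := h1 (l.take D1) (by simp; omega)
  have hb := h2 (l.drop D1) (by simp; omega)
  have hbS := prod_mem_S (S := S) hc (l.drop D1)
  generalize ((l.take D1).map c).prod = a at *
  generalize ((l.drop D1).map c).prod = b at *
  obtain ⟨y, hy, z, hz, rfl⟩ := Submodule.mem_sup.1 ha
  rw [add_mul]
  refine Submodule.add_mem _ (hP.right _ hbS _ hy) ?_
  clear ha
  induction hz using Submodule.span_induction with
  | zero => simp
  | add x y _ _ h1 h2 => rw [add_mul]; exact Submodule.add_mem _ h1 h2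
  | smul r x _ h => rw [smul_mul_assoc]; exact Submodule.smul_mem _ _ h
  | mem x h =>
    obtain ⟨s, hs, s', hs', rfl⟩ := h
    obtain ⟨y', hy', z', hz', rfl⟩ := Submodule.mem_sup.1 hb
    clear hb hbS
    rw [mul_add]
    have hx : ∀ x ∈ Submodule.span k {x | ∃ s ∈ S, ∃ s' ∈ S, x = s * g * s'},
        f * s' * x ∈ P := by
      intro x hx
      induction hx using Submodule.span_induction with
      | zero => simp
      | add x y _ _ h1 h2 => rw [mul_add]; exact Submodule.add_mem _ h1 h2
      | smul r x _ h => rw [mul_smul_comm]; exact Submodule.smul_mem _ _ h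
      | mem x h =>
        obtain ⟨t, ht, t', ht', rfl⟩ := h
        have := hP.right t' ht' _ (hcon (s' * t) (S.mul_mem hs' ht))
        simpa only [mul_assoc] using this
    refine Submodule.add_mem _
      (hP.left _ (S.mul_mem (S.mul_mem hs hfS) hs') _ hy') ?_
    have := hP.left s hs _ (hx z' hz')
    simpa only [mul_assoc] using this

lemma superword {κ : Type*} [Finite κ] [LinearOrder κ] {S : Submonoid R} {c : κ → R}
    {P : Submodule k R} (hP : SId S P) (hn : NonNil c P) (hc : ∀ j, c j ∈ S) :
    ∃ w : ℕ → κ, (∀ N, (((List.range N).map w).map c).prod ∉ P) ∧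
      ∀ v : ℕ → κ, (∃ n, (∀ i < n, v i = w i) ∧ v n < w n) →
        ∃ N, (((List.range N).map v).map c).prod ∈ P := by
  classical
  have := Fintype.ofFinite κ
  let Good : List κ → Prop := fun l => ∀ D, ∃ l' : List κ, l'.length = D ∧
    ((l ++ l').map c).prod ∉ P
  have hgood0 : Good [] := fun D => by simpa using hn D
  have hstep : ∀ l, Good l → (Finset.univ.filter (fun j => Good (l ++ [j]))).Nonempty := by
    intro l hl
    by_contra hcon
    have hcon' : ∀ j, ¬ Good (l ++ [j]) := by
      intro j hj
      exact hcon ⟨j, by simpa using hj⟩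
    simp only [Good] at hcon'
    push Not at hcon'
    choose D hD using hcon'
    obtain ⟨l', hl', hlP⟩ := hl (∑ j, D j + 1)
    match l', hl' with
    | j :: l'', hl' =>
      have hlen : l''.length = ∑ j, D j := by simpa using hl'
      have hle : D j ≤ l''.length := by
        rw [hlen]; exact Finset.single_le_sum (f := D) (fun _ _ => Nat.zero_le _) (Finset.mem_univ j)
      apply hlP
      have h1 := hD j (l''.take (D j)) (by simp; omega)
      have h2 := hP.right _ (prod_mem_S hc (l''.drop (D j))) _ h1
      rw [← List.prod_append, ← List.map_append] at h2
      simpa using h2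
  let nx : List κ → κ := fun l => if h : (Finset.univ.filter (fun j => Good (l ++ [j]))).Nonempty
    then (Finset.univ.filter (fun j => Good (l ++ [j]))).min' h
    else (Classical.choice ⟨(hstep [] hgood0).choose⟩)
  let L : ℕ → List κ := fun n => Nat.rec [] (fun _ l => l ++ [nx l]) n
  have hLs : ∀ n, L (n+1) = L n ++ [nx (L n)] := fun n => rfl
  have hnx : ∀ l, Good l → Good (l ++ [nx l]) ∧ ∀ j, Good (l ++ [j]) → nx l ≤ j := by
    intro l hl
    have h := hstep l hl
    simp only [nx, dif_pos h]
    constructor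
    · have := Finset.min'_mem _ h
      simpa using this
    · intro j hj
      exact Finset.min'_le _ _ (by simpa using hj)
  have hLg : ∀ n, Good (L n) := by
    intro n
    induction n with
    | zero => exact hgood0
    | succ n ih => rw [hLs]; exact (hnx _ ih).1
  have hLw : ∀ n, L n = (List.range n).map (fun i => nx (L i)) := by
    intro n
    induction n with
    | zero => rfl
    | succ n ih => rw [hLs, List.range_succ, List.map_append, ← ih]; rfl
  refine ⟨fun i => nx (L i), ?_, ?_⟩
  · intro N
    rw [← hLw]
    obtain ⟨l', hl', h⟩ := hLg N 0
    have : l' = [] := List.length_eq_zero_iff.1 hl'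
    subst this
    simpa using h
  · rintro v ⟨n, hlt, hvn⟩
    have hng : ¬ Good (L n ++ [v n]) := by
      intro hg
      exact absurd ((hnx _ (hLg n)).2 _ hg) (not_le.2 hvn)
    simp only [Good] at hng
    push Not at hng
    obtain ⟨D, hD⟩ := hng
    refine ⟨n + 1 + D, ?_⟩
    have e1 : (List.range (n+1)).map v = L n ++ [v n] := by
      rw [List.range_succ, List.map_append, hLw]
      congr 1
      apply List.map_congr_left
      intro i hi
      exact hlt i (List.mem_range.1 hi)
    have := hD ((List.range D).map (fun i => v (n+1+i))) (by simp)
    rw [← e1] at this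
    rw [List.range_add, List.map_append, List.map_map]
    exact this

lemma pairing {κ : Type*} [Finite κ] {S : Submonoid R} {c : κ → R}
    {P : Submodule k R} (hP : SId S P) (hn : NonNil c P) (hc : ∀ j, c j ∈ S)
    (q : ℕ) (hnil : ∀ l : List κ, 1 ≤ l.length → l.length < q → ∃ n, (l.map c).prod ^ n ∈ P) :
    ∃ (W X : ℕ → R) (e : R), e ∈ S ∧ e ∉ P ∧ (∀ i, W i ∈ S) ∧ (∀ i, X i ∈ S) ∧
      (∀ i < q, W i * X i = e) ∧ ∀ i < q, ∀ j < i, W i * X j ∈ P := by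
  classical
  let _ : LinearOrder κ := LinearOrder.lift' (Finite.equivFin κ) (Finite.equivFin κ).injective
  obtain ⟨w, hw, hmin⟩ := superword hP hn hc
  let B : ℕ → ℕ → R := fun a n => ((List.range' a n).map (fun i => c (w i))).prod
  have hBS : ∀ a n, B a n ∈ S := fun a n => by
    apply Submonoid.list_prod_mem
    intro x hx
    obtain ⟨j, _, rfl⟩ := List.mem_map.1 hx
    exact hc _
  have hBadd : ∀ a n m, B a (n + m) = B a n * B (a + n) m := by
    intro a n m
    simp only [B]
    rw [← List.prod_append, ← List.map_append]
    congr 2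
    have := (List.range'_append_1 (s := a) (m := n) (n := m)).symm
    simpa [Nat.add_comm] using this
  have hB0 : ∀ N, B 0 N ∉ P := by
    intro N
    have := hw N
    rw [List.map_map, List.range_eq_range'] at this
    exact this
  let T : ℕ → Lex (ℕ → κ) := fun a => toLex (fun n => w (a + n))
  have hTinj : Set.InjOn T (Finset.range q : Set ℕ) := by
    have key : ∀ i j, i < j → j < q → T i ≠ T j := by
      intro i j hij hj hT
      have hT' : ∀ n, w (i + n) = w (j + n) := fun n => congrFun (toLex.injective hT) n
      have hper : ∀ n, B i (n * (j - i)) = (B i (j - i)) ^ n := by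
        have hsh : ∀ m, B (i + (j - i)) m = B i m := by
          intro m
          have : i + (j - i) = j := by omega
          rw [this]
          simp only [B, List.range'_eq_map_range, List.map_map]
          congr 1
          apply List.map_congr_left
          intro x _
          simp [hT' x]
        intro n
        induction n with
        | zero => simp [B]
        | succ n ih => rw [add_mul, one_mul, add_comm, hBadd, hsh, ih, pow_succ']
      obtain ⟨n, hn'⟩ := hnil ((List.range' i (j - i)).map w) (by simp; omega) (by simp; omega)
      rw [List.map_map] at hn'
      have h2 : B i (n * (j - i)) ∈ P := by rw [hper]; exact hn'
      have h3 := hP.left _ (hBS 0 i) _ h2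
      have h4 := hBadd 0 i (n * (j - i))
      rw [zero_add] at h4
      rw [← h4] at h3
      exact hB0 _ h3
    intro i hi j hj hT
    simp only [Finset.coe_range, Set.mem_Iio] at hi hj
    rcases lt_trichotomy i j with h | h | h
    · exact absurd hT (key i j h hj)
    · exact h
    · exact absurd hT.symm (key j i h hi)
  have hcard : ((Finset.range q).image T).card = q := by
    rw [Finset.card_image_of_injOn hTinj, Finset.card_range]
  let f := ((Finset.range q).image T).orderEmbOfFin hcard
  have hf : ∀ i : Fin q, ∃ p, p < q ∧ T p = f i := by
    intro i
    have := Finset.orderEmbOfFin_mem _ hcard i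
    obtain ⟨p, hp, hp'⟩ := Finset.mem_image.1 this
    exact ⟨p, Finset.mem_range.1 hp, hp'⟩
  choose p' hp'q hp'f using hf
  let p : ℕ → ℕ := fun i => if h : i < q then p' ⟨i, h⟩ else 0
  have hpq : ∀ i, p i ≤ q := by
    intro i
    simp only [p]
    split_ifs with h
    · exact (hp'q _).le
    · omega
  have hpT : ∀ i j, j < i → i < q → T (p j) < T (p i) := by
    intro i j hji hi
    simp only [p, dif_pos hi, dif_pos (hji.trans hi), hp'f]
    apply f.strictMono
    exact hji
  have hN : ∀ i j, ∃ N, j < i → i < q → ∀ M, N ≤ M → B 0 (p i) * B (p j) M ∈ P := by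
    intro i j
    by_cases h : j < i ∧ i < q
    · have hlt := hpT i j h.1 h.2
      obtain ⟨n, hn1, hn2⟩ := hlt
      change ∀ m < n, w (p j + m) = w (p i + m) at hn1
      change w (p j + n) < w (p i + n) at hn2
      obtain ⟨N, hN⟩ := hmin (fun m => if m < p i then w m else w (p j + (m - p i)))
        ⟨p i + n, by
          intro m hm
          by_cases hmi : m < p i
          · simp [hmi]
          · simp only [hmi, if_false]
            rw [hn1 (m - p i) (by omega)]
            congr 1; omega, by simpa using hn2⟩
      refine ⟨N, fun _ _ M hM => ?_⟩
      have h1 : B 0 (p i) * B (p j) M = (((List.range (p i + M)).map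
          (fun m => if m < p i then w m else w (p j + (m - p i)))).map c).prod := by
        simp only [B]
        rw [← List.prod_append, List.range_add, List.map_append, List.map_append, List.map_map,
          List.map_map, List.map_map]
        congr 2
        · rw [← List.range_eq_range']
          apply List.map_congr_left
          intro x hx
          simp [List.mem_range.1 hx]
        · rw [List.range'_eq_map_range, List.map_map]
          apply List.map_congr_left
          intro x hx
          simp
      rw [h1]
      have h2 : p i + M = N + (p i + M - N) := by omega
      rw [h2, List.range_add, List.map_append, List.map_append, List.prod_append]
      refine hP.right _ (prod_mem_S hc _) _ hN
    · exact ⟨0, fun h1 h2 => absurd ⟨h1, h2⟩ h⟩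
  choose N hN using hN
  let M := q + ∑ i ∈ Finset.range q, ∑ j ∈ Finset.range q, N i j
  have hM : ∀ i j, i < q → j < q → q + N i j ≤ M := by
    intro i j hi hj
    have h1 : N i j ≤ ∑ j ∈ Finset.range q, N i j :=
      Finset.single_le_sum (f := fun j => N i j) (fun _ _ => Nat.zero_le _) (Finset.mem_range.2 hj)
    have h2 : ∑ j ∈ Finset.range q, N i j ≤ ∑ i ∈ Finset.range q, ∑ j ∈ Finset.range q, N i j :=
      Finset.single_le_sum (f := fun i => ∑ j ∈ Finset.range q, N i j)
        (fun _ _ => Nat.zero_le _) (Finset.mem_range.2 hi)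
    simp only [M]; omega
  refine ⟨fun i => B 0 (p i), fun j => B (p j) (M - p j), B 0 M, hBS _ _, hB0 _,
    fun _ => hBS _ _, fun _ => hBS _ _, ?_, ?_⟩
  · intro i hi
    have h1 := hM i i hi hi
    have h2 := hpq i
    have h3 := hBadd 0 (p i) (M - p i)
    rw [zero_add, Nat.add_sub_cancel' (by omega)] at h3
    exact h3.symm
  · intro i hi j hj
    have h1 := hM i j hi (by omega)
    have h2 := hpq j
    exact hN i j hj hi _ (by omega)

lemma prod_mem_of_not_chain {S : Submonoid R} {P : Submodule k R} (hP : SId S P)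
    {y : ℕ → R} (hy : ∀ i, y i ∈ S) (r : ℕ → ℕ → Prop) (l : List ℕ)
    (h : ∀ a ∈ l, ∀ b ∈ l, ¬ r a b → y a * y b ∈ P) (hl : ¬ l.IsChain r) :
    (l.map y).prod ∈ P := by
  rw [List.isChain_iff_forall_rel_of_append_cons_cons] at hl
  push Not at hl
  obtain ⟨a, b, l1, l2, rfl, hab⟩ := hl
  have h1 := h a (by simp) b (by simp) hab
  have h2 := hP.right _ (prod_mem_S hy l2) _ (hP.left _ (prod_mem_S hy l1) _ h1)
  simpa [mul_assoc] using h2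

lemma eq_range_of_chain {l : List ℕ} {K : ℕ} (hp : l.Perm (List.range K))
    (hc : l.IsChain (· < ·)) : l = List.range K := by
  have h1 : l.Pairwise (· < ·) := List.isChain_iff_pairwise.1 hc
  have h2 : (List.range K).Pairwise (· < ·) := List.pairwise_lt_range
  exact hp.eq_of_pairwise (fun a b _ _ h h' => absurd h (not_lt.2 h'.le)) h1 h2

/-- A monic multilinear identity valid on `S`. -/
def HasML (S : Submonoid R) : Prop :=
  ∃ (K : ℕ) (Ω : Type) (_ : Fintype Ω) (ε : Ω → ℤ) (wd : Ω → List ℕ) (ω₀ : Ω),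
    (∀ ω, (wd ω).Perm (List.range K)) ∧ wd ω₀ = List.range K ∧ ε ω₀ = 1 ∧
    (∀ ω, wd ω = List.range K → ω = ω₀) ∧
    ∀ y : ℕ → R, (∀ i, y i ∈ S) → ∑ ω, ε ω • ((wd ω).map y).prod = 0

lemma nil_of_all_nil {κ : Type*} [Finite κ] {S : Submonoid R} {c : κ → R} (hc : ∀ j, c j ∈ S)
    (hML : HasML S) {P0 : Submodule k R} (hP0 : SId S P0)
    (hnil : ∀ l : List κ, l ≠ [] → ∃ n, (l.map c).prod ^ n ∈ P0) :
    ∃ D, ∀ l : List κ, l.length = D → (l.map c).prod ∈ P0 := by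
  classical
  by_contra hcon
  push Not at hcon
  obtain ⟨P, hle, hP, hn, hmax⟩ := exists_max S c P0 hP0 hcon
  obtain ⟨K, Ω, _, ε, wd, ω₀, hperm, hw0, he0, huniq, hid⟩ := hML
  obtain ⟨W, X, e, heS, heP, hW, hX, hWX, hWX'⟩ := pairing hP hn hc (K + 1) (fun l hl _ => by
    obtain ⟨n, h⟩ := hnil l (by rintro rfl; simp at hl)
    exact ⟨n, hle h⟩)
  have hz : ∃ z H : ℕ → R, H 0 = e ∧ (∀ n, H (n + 1) = H n * z n * e) ∧
      (∀ n, H n ∉ P) ∧ ∀ n, z n ∈ S := by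
    have hex : ∀ x : {x : R // x ∈ S ∧ x ∉ P}, ∃ s ∈ S, x.1 * s * e ∉ P := fun x =>
      exists_mul_notMem hP hn hmax hc x.2.1 x.2.2 heP
    choose g hgS hgP using hex
    let H : ℕ → {x : R // x ∈ S ∧ x ∉ P} := fun n => Nat.rec ⟨e, heS, heP⟩
      (fun _ x => ⟨x.1 * g x * e, S.mul_mem (S.mul_mem x.2.1 (hgS x)) heS, hgP x⟩) n
    exact ⟨fun n => g (H n), fun n => (H n).1, rfl, fun n => rfl, fun n => (H n).2.2,
      fun n => hgS _⟩
  obtain ⟨z, H, hH0, hH1, hHP, hzS⟩ := hz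
  let y : ℕ → R := fun t => X t * z t * W (t + 1)
  have hyS : ∀ t, y t ∈ S := fun t => S.mul_mem (S.mul_mem (hX _) (hzS _)) (hW _)
  have hHn : ∀ n, n ≤ K → W 0 * ((List.range n).map y).prod * X n = H n := by
    intro n
    induction n with
    | zero => intro _; simp [hH0, hWX 0 (by omega)]
    | succ n ih =>
      intro hn
      rw [hH1, ← ih (by omega), ← hWX (n + 1) (by omega), List.range_succ, List.map_append,
        List.prod_append]
      simp only [List.map_cons, List.map_nil, List.prod_singleton, y, mul_assoc]
  have hsum := hid y hyS
  have hother : ∀ ω, ω ≠ ω₀ → ((wd ω).map y).prod ∈ P := by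
    intro ω hω
    apply prod_mem_of_not_chain hP hyS (· < ·)
    · intro a ha b hb hab
      have ha' : a < K := by simpa using (hperm ω).subset ha
      have h1 := hWX' (a + 1) (by omega) b (by omega)
      have h2 := hP.right _ (S.mul_mem (hzS b) (hW (b+1))) _
        (hP.left _ (S.mul_mem (hX a) (hzS a)) _ h1)
      simpa only [y, mul_assoc] using h2
    · intro hch
      exact hω (huniq ω (eq_range_of_chain (hperm ω) hch))
  rw [← Finset.add_sum_erase _ _ (Finset.mem_univ ω₀), he0, one_smul, hw0] at hsum
  have h1 : ((List.range K).map y).prod ∈ P := by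
    rw [eq_neg_of_add_eq_zero_left hsum]
    apply Submodule.neg_mem
    apply Submodule.sum_mem
    intro ω hω
    exact zsmul_mem (hother ω (Finset.ne_of_mem_erase hω)) _
  apply hHP K
  rw [← hHn K le_rfl]
  exact hP.right _ (hX _) _ (hP.left _ (hW _) _ h1)

/-- Evaluation of the standard polynomial. -/
def st (d : ℕ) (y : ℕ → R) : R :=
  ∑ σ : Equiv.Perm (Fin d), (Equiv.Perm.sign σ : ℤ) •
    ((List.finRange d).map (fun i => y ((σ i : Fin d) : ℕ))).prod

lemma perm_list {d : ℕ} (σ : Equiv.Perm (Fin d)) :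
    ((List.finRange d).map (fun i => ((σ i : Fin d) : ℕ))).Perm (List.range d) := by
  have h := (Equiv.Perm.map_finRange_perm σ).map (fun i : Fin d => (i : ℕ))
  rw [List.map_map] at h
  have h2 : (List.finRange d).map (fun i : Fin d => (i : ℕ)) = List.range d := by
    simp
  rw [h2] at h
  exact h

lemma perm_list_eq {d : ℕ} (σ : Equiv.Perm (Fin d))
    (h : (List.finRange d).map (fun i => ((σ i : Fin d) : ℕ)) = List.range d) : σ = 1 := by
  have h2 : (List.finRange d).map (fun i : Fin d => (i : ℕ)) = List.range d := by
    simp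
  rw [← h2, List.map_inj_left] at h
  ext i
  exact h i (by simp)

lemma st_mul_mem {S : Submonoid R} {P : Submodule k R} (hP : SId S P)
    {y : ℕ → R} (hy : ∀ i, y i ∈ S) (d : ℕ) {p : R} (hp : p ∈ P) : st d y * p ∈ P := by
  rw [st, Finset.sum_mul]
  apply Submodule.sum_mem
  intro σ _
  rw [smul_mul_assoc]
  apply zsmul_mem
  refine hP.left _ (prod_mem_S (fun i => hy _) _) _ hp

lemma st_nil {S : Submonoid R} {P : Submodule k R} (hP : SId S P) (r m : ℕ) (hr : 1 ≤ r)
    (hst : ∀ y : ℕ → R, (∀ i, y i ∈ S) → st (2 * r) y ^ m = 0)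
    {W X : ℕ → R} {e : R} (hW : ∀ i, W i ∈ S) (hX : ∀ i, X i ∈ S)
    (hWX : ∀ i < r + 1, W i * X i = e) (hWX' : ∀ i < r + 1, ∀ j < i, W i * X j ∈ P)
    {z : R} (hz : z ∈ S) : (e * z) ^ (2 * r * m) * e ∈ P := by
  classical
  let α : ℕ → ℕ := fun l => if l = 0 then 0 else l / 2 + 1
  let β : ℕ → ℕ := fun l => if l + 1 = 2 * r then 0 else α (l + 1)
  let y : ℕ → R := fun l => X (α l) * z * W (β l)
  have hyS : ∀ t, y t ∈ S := fun t => S.mul_mem (S.mul_mem (hX _) hz) (hW _)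
  have hα : ∀ l, l < 2 * r → α l ≤ r := by
    intro l hl; simp only [α]; split_ifs <;> omega
  have hβ : ∀ l, l < 2 * r → β l ≤ r := by
    intro l hl; simp only [β, α]; split_ifs <;> omega
  have hβ' : ∀ l, l + 1 ≠ 2 * r → β l = (l + 1) / 2 + 1 := by
    intro l hl
    simp only [β, α]
    rw [if_neg hl, if_neg (Nat.succ_ne_zero l)]
  set Y := ((List.range (2 * r)).map y).prod with hYdef
  have hYS : Y ∈ S := prod_mem_S hyS _
  -- adjacent pairs
  have hadj : ∀ a, a < 2 * r → ∀ b, α b < β a → y a * y b ∈ P := by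
    intro a ha b hb
    have h1 := hWX' (β a) (by have := hβ a ha; omega) (α b) hb
    have h2 := hP.right _ (S.mul_mem hz (hW (β b))) _
        (hP.left _ (S.mul_mem (hX (α a)) hz) _ h1)
    simpa only [y, mul_assoc] using h2
  have hstep : ∀ h ∈ S, (∀ i, 0 < i → i ≤ r → W i * h ∈ P) →
      st (2 * r) y * h - Y * h ∈ P := by
    intro h hhS hh
    rw [st, Finset.sum_mul, ← Finset.add_sum_erase _ _ (Finset.mem_univ 1)]
    have e1 : ((Equiv.Perm.sign (1 : Equiv.Perm (Fin (2 * r))) : ℤ) •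
        ((List.finRange (2 * r)).map
          (fun i => y (((1 : Equiv.Perm (Fin (2 * r))) i : Fin (2 * r)) : ℕ))).prod) = Y := by
      have h2 : List.range (2 * r) = (List.finRange (2 * r)).map (fun i : Fin (2 * r) => (i : ℕ)) := by
        simp
      rw [hYdef, h2, List.map_map]
      simp [Function.comp_def]
    rw [e1, add_sub_cancel_left]
    apply Submodule.sum_mem
    intro σ hσ
    have hσ1 : σ ≠ 1 := Finset.ne_of_mem_erase hσ
    rw [smul_mul_assoc]
    apply zsmul_mem
    have e2 : (List.finRange (2 * r)).map (fun i => y ((σ i : Fin (2 * r)) : ℕ)) =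
      ((List.finRange (2 * r)).map (fun i => ((σ i : Fin (2 * r)) : ℕ))).map y := by
      rw [List.map_map]; rfl
    rw [e2]
    have hperm := perm_list σ
    have hne : (List.finRange (2 * r)).map (fun i => ((σ i : Fin (2 * r)) : ℕ)) ≠
      List.range (2 * r) := fun h => hσ1 (perm_list_eq σ h)
    generalize (List.finRange (2 * r)).map (fun i => ((σ i : Fin (2 * r)) : ℕ)) = l at hperm hne
    have hlt : ∀ a ∈ l, a < 2 * r := fun a ha => by simpa using hperm.subset ha
    have hnd : l.Nodup := hperm.nodup_iff.2 List.nodup_range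
    by_cases hch : l.IsChain (fun a b => a ≤ b ∨ a + 1 = 2 * r)
    · rcases List.eq_nil_or_concat l with rfl | ⟨l', x, rfl⟩
      · have := hperm.length_eq
        simp at this; omega
      · rw [List.concat_eq_append] at *
        by_cases hx : x + 1 = 2 * r
        · exfalso
          apply hne
          apply eq_range_of_chain hperm
          rw [List.isChain_iff_forall_rel_of_append_cons_cons] at hch ⊢
          intro a b l1 l2 hl
          rcases hch hl with h | h
          · refine lt_of_le_of_ne h ?_
            rintro rfl
            rw [hl] at hnd
            simp [List.nodup_append] at hnd
          · exfalso
            have hax : a = x := by omega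
            subst hax
            rcases List.eq_nil_or_concat l2 with rfl | ⟨l3, x', rfl⟩
            · have hl' : l' ++ [a] = (l1 ++ [a]) ++ [b] := by simpa using hl
              have := List.append_inj_right' hl' rfl
              simp only [List.cons.injEq, and_true] at this
              subst this
              rw [hl] at hnd
              simp [List.nodup_append] at hnd
            · have hl' : l' ++ [a] = (l1 ++ a :: b :: l3) ++ [x'] := by simpa using hl
              have := List.append_inj_right' hl' rfl
              simp only [List.cons.injEq, and_true] at this
              subst this
              rw [hl] at hnd
              simp [List.nodup_append] at hnd
        · have hx2 := hlt x (by simp)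
          have h1 := hh (β x) (by rw [hβ' x hx]; omega) (hβ x hx2)
          have h2 := hP.left _ (S.mul_mem (prod_mem_S hyS l') (S.mul_mem (hX (α x)) hz)) _ h1
          simpa [y, mul_assoc] using h2
    · refine hP.right _ hhS _ (prod_mem_of_not_chain hP hyS _ l ?_ hch)
      intro a ha b hb hab
      push Not at hab
      apply hadj a (hlt a ha)
      rw [hβ' a hab.2]
      simp only [α]
      split_ifs <;> omega
  have hYj : ∀ j, Y ^ j * X 0 ∈ S ∧ ∀ i, 0 < i → i ≤ r → W i * (Y ^ j * X 0) ∈ P := by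
    intro j
    refine ⟨S.mul_mem (S.pow_mem hYS j) (hX 0), fun i hi hir => ?_⟩
    have h0 := hWX' i (by omega) 0 hi
    cases j with
    | zero => simpa using h0
    | succ j =>
      obtain ⟨d, hd⟩ : ∃ d, 2 * r = d + 1 := ⟨2 * r - 1, by omega⟩
      have hY0 : Y = y 0 * ((List.range d).map (fun i => y (i + 1))).prod := by
        rw [hYdef, hd, List.range_succ_eq_map]
        simp [List.map_map, Function.comp_def]
      have hS2 : ((List.range d).map (fun i => y (i + 1))).prod ∈ S :=
        prod_mem_S (fun i => hyS _) _
      have h2 := hP.right _ (S.mul_mem (S.mul_mem (S.mul_mem hz (hW (β 0))) hS2)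
        (S.mul_mem (S.pow_mem hYS j) (hX 0))) _ h0
      rw [pow_succ']
      nth_rewrite 1 [hY0]
      have hy0 : y 0 = X 0 * z * W (β 0) := rfl
      rw [hy0]
      simpa only [mul_assoc] using h2
  have hpow : ∀ j, st (2 * r) y ^ j * X 0 - Y ^ j * X 0 ∈ P := by
    intro j
    induction j with
    | zero => simp
    | succ j ih =>
      have h1 := st_mul_mem hP hyS (2 * r) ih
      have h2 := hstep _ (hYj j).1 (hYj j).2
      have h3 := Submodule.add_mem _ h1 h2
      rw [pow_succ', pow_succ']
      convert h3 using 1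
      noncomm_ring
  have hfin := hpow m
  rw [hst y hyS, zero_mul, zero_sub, Submodule.neg_mem_iff] at hfin
  have hW0 := hP.left _ (hW 0) _ hfin
  have hpart : ∀ n, n < 2 * r → W 0 * ((List.range n).map y).prod = (e * z) ^ n * W (α n) := by
    intro n
    induction n with
    | zero => intro _; simp [α]
    | succ n ih =>
      intro hn
      rw [List.range_succ, List.map_append, List.prod_append, ← mul_assoc, ih (by omega)]
      have hb : β n = α (n + 1) := by simp only [β]; rw [if_neg (by omega)]
      have h1 := hWX (α n) (by have := hα n (by omega); omega)
      simp only [List.map_cons, List.map_nil, List.prod_singleton, y, hb]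
      rw [pow_succ]
      calc (e * z) ^ n * W (α n) * (X (α n) * z * W (α (n + 1)))
          = (e * z) ^ n * (W (α n) * X (α n)) * z * W (α (n + 1)) := by simp only [mul_assoc]
        _ = _ := by rw [h1]; simp only [mul_assoc]
  have hfull : W 0 * Y = (e * z) ^ (2 * r) * W 0 := by
    obtain ⟨d, hd⟩ : ∃ d, 2 * r = d + 1 := ⟨2 * r - 1, by omega⟩
    have hb : β d = 0 := by simp only [β]; rw [if_pos (by omega)]
    have h1 := hWX (α d) (by have := hα d (by omega); omega)
    rw [hYdef, hd, List.range_succ, List.map_append, List.prod_append, ← mul_assoc,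
      hpart d (by omega)]
    simp only [List.map_cons, List.map_nil, List.prod_singleton, y, hb]
    rw [pow_succ]
    calc (e * z) ^ d * W (α d) * (X (α d) * z * W 0)
        = (e * z) ^ d * (W (α d) * X (α d)) * z * W 0 := by simp only [mul_assoc]
      _ = _ := by rw [h1]; simp only [mul_assoc]
  have hpw : ∀ j, W 0 * Y ^ j = (e * z) ^ (2 * r * j) * W 0 := by
    intro j
    induction j with
    | zero => simp
    | succ j ih =>
      rw [pow_succ, ← mul_assoc, ih, mul_assoc, hfull, ← mul_assoc, ← pow_add]
      rfl
  rw [← mul_assoc, hpw, mul_assoc, hWX 0 (by omega)] at hW0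
  exact hW0

lemma sup_span_mul {S : Submonoid R} {P Q : Submodule k R} (hP : SId S P) (hPQ : P ≤ Q)
    {A B : Set R} (hA : ∀ a ∈ A, a ∈ S) (hAB : ∀ a ∈ A, ∀ b ∈ B, a * b ∈ Q)
    {u v : R} (hu : u ∈ P ⊔ Submodule.span k A) (hv : v ∈ P ⊔ Submodule.span k B)
    (hvS : v ∈ S) : u * v ∈ Q := by
  obtain ⟨p, hp, x, hx, rfl⟩ := Submodule.mem_sup.1 hu
  rw [add_mul]
  refine Submodule.add_mem _ (hPQ (hP.right _ hvS _ hp)) ?_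
  clear hu
  induction hx using Submodule.span_induction with
  | zero => simp
  | add x y _ _ h1 h2 => rw [add_mul]; exact Submodule.add_mem _ h1 h2
  | smul r x _ h => rw [smul_mul_assoc]; exact Submodule.smul_mem _ _ h
  | mem a ha =>
    obtain ⟨p', hp', y, hy, rfl⟩ := Submodule.mem_sup.1 hv
    clear hv hvS
    rw [mul_add]
    refine Submodule.add_mem _ (hPQ (hP.left _ (hA a ha) _ hp')) ?_
    induction hy using Submodule.span_induction with
    | zero => simp
    | add x y _ _ h1 h2 => rw [mul_add]; exact Submodule.add_mem _ h1 h2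
    | smul r x _ h => rw [mul_smul_comm]; exact Submodule.smul_mem _ _ h
    | mem b hb => exact hAB a ha b hb

lemma core {κ : Type*} [Finite κ] {S : Submonoid R} {c : κ → R} (hc : ∀ j, c j ∈ S)
    (hML : HasML S) {P0 : Submodule k R} (hP0 : SId S P0) (r m : ℕ) (hr : 1 ≤ r)
    (hst : ∀ y : ℕ → R, (∀ i, y i ∈ S) → st (2 * r) y ^ m = 0)
    (hnil : ∀ l : List κ, 1 ≤ l.length → l.length ≤ r → ∃ n, (l.map c).prod ^ n ∈ P0) :
    ∃ D, ∀ l : List κ, l.length = D → (l.map c).prod ∈ P0 := by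
  classical
  by_contra hcon
  push Not at hcon
  obtain ⟨P, hle, hP, hn, hmax⟩ := exists_max S c P0 hP0 hcon
  obtain ⟨W, X, e, heS, heP, hW, hX, hWX, hWX'⟩ := pairing hP hn hc (r + 1) (fun l hl hl' => by
    obtain ⟨n, h⟩ := hnil l hl (by omega)
    exact ⟨n, hle h⟩)
  have hE : ∀ z ∈ S, (e * z) ^ (2 * r * m + 1) ∈ P := by
    intro z hz
    have h := hP.right _ hz _ (st_nil hP r m hr hst hW hX hWX hWX' hz)
    rw [pow_succ, ← mul_assoc]
    exact h
  obtain ⟨D, hD⟩ := hmax e heP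
  -- a finite set of relevant elements
  have hfin : ∃ T : Finset R, (↑T ⊆ {x | ∃ s ∈ S, ∃ s' ∈ S, x = s * e * s'}) ∧
      ∀ l : List κ, l.length = D → (l.map c).prod ∈ P ⊔ Submodule.span k (↑T : Set R) := by
    have key : ∀ U : Finset (List κ), (∀ l ∈ U, l.length = D) →
        ∃ T : Finset R, (↑T ⊆ {x | ∃ s ∈ S, ∃ s' ∈ S, x = s * e * s'}) ∧
        ∀ l ∈ U, (l.map c).prod ∈ P ⊔ Submodule.span k (↑T : Set R) := by
      intro U
      induction U using Finset.induction_on with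
      | empty => intro _; exact ⟨∅, by simp, by simp⟩
      | insert a U _ ih =>
        intro h
        obtain ⟨T1, hT1, h1⟩ := ih (fun l hl => h l (Finset.mem_insert_of_mem hl))
        obtain ⟨p, hp, y, hy, hpy⟩ := Submodule.mem_sup.1 (hD a (h a (Finset.mem_insert_self _ _)))
        obtain ⟨T2, hT2, h2⟩ := Submodule.mem_span_finite_of_mem_span hy
        refine ⟨T1 ∪ T2, ?_, ?_⟩
        · rw [Finset.coe_union]; exact Set.union_subset hT1 hT2
        · intro l hl
          rcases Finset.mem_insert.1 hl with rfl | hl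
          · rw [← hpy]
            refine Submodule.add_mem_sup hp (Submodule.span_mono ?_ h2)
            simp
          · refine sup_le_sup_left (Submodule.span_mono ?_) P (h1 l hl)
            simp
    obtain ⟨T, hT, h⟩ := key (List.finite_length_eq κ D).toFinset (by simp)
    exact ⟨T, hT, fun l hl => h l (by simpa using hl)⟩
  obtain ⟨T, hT, hTD⟩ := hfin
  have hT' : ∀ x : T, ∃ s ∈ S, ∃ s' ∈ S, x.1 = s * e * s' := fun x => hT x.2
  choose s hs s' hs' hss using hT'
  let c' : T × T → R := fun x => e * (s' x.1 * s x.2)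
  have hc' : ∀ j, c' j ∈ S := fun j => S.mul_mem heS (S.mul_mem (hs' _) (hs _))
  obtain ⟨M, hM⟩ := nil_of_all_nil hc' hML hP (by
    intro l hl
    match l, hl with
    | j :: l, _ =>
      refine ⟨2 * r * m + 1, ?_⟩
      have := hE (s' j.1 * s j.2 * (l.map c').prod)
        (S.mul_mem (S.mul_mem (hs' _) (hs _)) (prod_mem_S hc' l))
      simpa only [List.map_cons, List.prod_cons, c', mul_assoc] using this)
  let G : ℕ → Set R := fun n => {x | ∃ a b : T, ∃ l : List (T × T), l.length = n ∧
    x = s a * (l.map c').prod * (e * s' b)}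
  have hGS : ∀ n, ∀ x ∈ G n, x ∈ S := by
    rintro n x ⟨a, b, l, _, rfl⟩
    exact S.mul_mem (S.mul_mem (hs _) (prod_mem_S hc' l)) (S.mul_mem heS (hs' _))
  have hG : ∀ n, ∀ l : List κ, l.length = D * (n + 1) →
      (l.map c).prod ∈ P ⊔ Submodule.span k (G n) := by
    intro n
    induction n with
    | zero =>
      intro l hl
      refine sup_le_sup_left (Submodule.span_mono ?_) P (hTD l (by simpa using hl))
      intro x hx
      exact ⟨⟨x, hx⟩, ⟨x, hx⟩, [], rfl, by simpa [mul_assoc] using hss ⟨x, hx⟩⟩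
    | succ n ih =>
      intro l hl
      have hl2 : l.length = D * (n + 1) + D := by rw [hl]; ring
      rw [← List.take_append_drop (D * (n + 1)) l, List.map_append, List.prod_append]
      refine sup_span_mul hP le_sup_left (hGS n) ?_
        (ih _ (by rw [List.length_take]; omega))
        (hTD _ (by rw [List.length_drop]; omega)) (prod_mem_S hc _)
      rintro _ ⟨a, b, l', hl', rfl⟩ x hx
      refine Submodule.mem_sup_right (Submodule.subset_span
        ⟨a, ⟨x, hx⟩, l' ++ [(b, ⟨x, hx⟩)], by simp [hl'], ?_⟩)
      have := hss ⟨x, hx⟩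
      simp only at this
      rw [List.map_append, List.prod_append]
      conv_lhs => rw [this]
      simp only [List.map_cons, List.map_nil, List.prod_singleton, c', mul_assoc]
  obtain ⟨l, hl, hlP⟩ := hn (D * (M + 1))
  apply hlP
  have := hG M l hl
  rw [sup_eq_left.2] at this
  · exact this
  · rw [Submodule.span_le]
    rintro _ ⟨a, b, l', hl', rfl⟩
    exact hP.right _ (S.mul_mem heS (hs' _)) _ (hP.left _ (hs _) _ (hM l' hl'))

lemma st_expand (d m : ℕ) (y : ℕ → R) :
    st d (fun l => ∑ i : Fin m, y (d * i + l)) =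
      ∑ ω : Equiv.Perm (Fin d) × (Fin d → Fin m), (Equiv.Perm.sign ω.1 : ℤ) •
        ((List.ofFn (fun j => d * (ω.2 j : ℕ) + (ω.1 j : ℕ))).map y).prod := by
  rw [Fintype.sum_prod_type]
  unfold st
  refine Finset.sum_congr rfl fun σ _ => ?_
  simp only
  rw [← Finset.smul_sum]
  congr 1
  have := (MultilinearMap.mkPiAlgebraFin ℤ d R).map_sum
    (fun (j : Fin d) (i : Fin m) => y (d * i + (σ j : ℕ)))
  simp only [MultilinearMap.mkPiAlgebraFin_apply] at this
  rw [← List.ofFn_eq_map, this]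
  refine Finset.sum_congr rfl fun c _ => ?_
  rw [List.map_ofFn]
  rfl

lemma ofFn_eq_range (d m a : ℕ) (σ : Equiv.Perm (Fin d)) (c : Fin d → Fin m)
    (h : List.ofFn (fun j => d * (c j : ℕ) + (σ j : ℕ)) = List.range' (d * a) d) :
    σ = 1 ∧ ∀ j, (c j : ℕ) = a := by
  have h1 : ∀ j : Fin d, d * (c j : ℕ) + (σ j : ℕ) = d * a + j := by
    intro j
    have := congrArg (fun l => l[(j : ℕ)]?) h
    simpa using this
  have h2 : ∀ j : Fin d, (c j : ℕ) = a ∧ (σ j : ℕ) = j := by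
    intro j
    have hd : 0 < d := j.pos
    have e := h1 j
    have e1 := congrArg (· / d) e
    have e2 := congrArg (· % d) e
    simp only [Nat.mul_add_div hd, Nat.mul_add_mod, Nat.div_eq_of_lt (σ j).2, Nat.div_eq_of_lt j.2,
      Nat.mod_eq_of_lt (σ j).2, Nat.mod_eq_of_lt j.2] at e1 e2
    exact ⟨by simpa using e1, e2⟩
  exact ⟨Equiv.ext fun j => Fin.ext (h2 j).2, fun j => (h2 j).1⟩

lemma ofFn_one_eq_range (d m : ℕ) (a : Fin m) :
    List.ofFn (fun j : Fin d => d * (a : ℕ) + (((1 : Equiv.Perm (Fin d)) j : Fin d) : ℕ))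
      = List.range' (d * a) d := by
  apply List.ext_getElem <;> simp

lemma st_pow_expand (d m : ℕ) (m' : ℕ) :
    ∃ (Ω : Type) (_ : Fintype Ω) (ε : Ω → ℤ) (wd : Ω → List ℕ),
      (∀ y : ℕ → R, st d (fun l => ∑ i : Fin m, y (d * i + l)) ^ m' =
        ∑ ω, ε ω • ((wd ω).map y).prod) ∧
      (∀ ω, (wd ω).length = d * m') ∧
      ∀ a, a + m' ≤ m → ∃ ω₁, wd ω₁ = List.range' (d * a) (d * m') ∧ ε ω₁ = 1 ∧
        ∀ ω, wd ω = List.range' (d * a) (d * m') → ω = ω₁ := by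
  induction m' with
  | zero =>
    exact ⟨Unit, inferInstance, fun _ => 1, fun _ => [], by simp, by simp,
      fun a _ => ⟨(), by simp, rfl, fun _ _ => rfl⟩⟩
  | succ m' ih =>
    obtain ⟨Ω, _, ε, wd, h1, h2, h3⟩ := ih
    refine ⟨(Equiv.Perm (Fin d) × (Fin d → Fin m)) × Ω, inferInstance,
      fun ω => (Equiv.Perm.sign ω.1.1 : ℤ) * ε ω.2,
      fun ω => List.ofFn (fun j => d * (ω.1.2 j : ℕ) + (ω.1.1 j : ℕ)) ++ wd ω.2, ?_, ?_, ?_⟩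
    · intro y
      rw [pow_succ', h1, st_expand, Finset.sum_mul_sum]
      refine Eq.trans ?_ (Fintype.sum_prod_type _).symm
      refine Finset.sum_congr rfl fun x _ => Finset.sum_congr rfl fun z _ => ?_
      rw [List.map_append, List.prod_append, smul_mul_smul_comm]
    · intro ω
      simp [h2]
      ring
    · intro a ha
      obtain ⟨ω₁, e1, e2, e3⟩ := h3 (a + 1) (by omega)
      have hsplit : List.range' (d * a) (d * (m' + 1)) =
          List.range' (d * a) d ++ List.range' (d * (a + 1)) (d * m') := by
        rw [Nat.mul_succ d a, List.range'_append_1]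
        congr 1; ring
      refine ⟨((1, fun _ => ⟨a, by omega⟩), ω₁), ?_, by simp [e2], ?_⟩
      · dsimp only
        rw [hsplit, e1]
        congr 1
        exact ofFn_one_eq_range d m ⟨a, by omega⟩
      · rintro ⟨⟨σ, c⟩, ω⟩ h
        rw [hsplit] at h
        obtain ⟨h5, h6⟩ := List.append_inj h (by simp)
        obtain ⟨rfl, h7⟩ := ofFn_eq_range d m a σ c h5
        rw [e3 ω h6]
        simp only [Prod.mk.injEq, true_and, and_true]
        funext j
        exact Fin.ext (h7 j)

lemma linearize {Ω : Type} [Fintype Ω] (ε : Ω → ℤ) (wd : Ω → List ℕ)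
    (h : ∀ y : ℕ → R, ∑ ω, ε ω • ((wd ω).map y).prod = 0) (J : Finset ℕ) :
    ∀ y : ℕ → R, ∑ ω with ∀ j ∈ J, j ∈ wd ω, ε ω • ((wd ω).map y).prod = 0 := by
  classical
  induction J using Finset.induction_on with
  | empty => simpa using h
  | insert j J hj ih =>
    intro y
    have h1 := ih y
    have h2 := ih (Function.update y j 0)
    rw [← Finset.sum_filter_add_sum_filter_not _ (fun ω => j ∈ wd ω)] at h1 h2
    rw [Finset.sum_eq_zero (s := Finset.filter (fun ω => j ∈ wd ω) _), zero_add] at h2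
    · have h3 : ∑ ω ∈ (Finset.univ.filter (fun ω => ∀ j ∈ J, j ∈ wd ω)).filter
          (fun ω => ¬ j ∈ wd ω), ε ω • ((wd ω).map y).prod = 0 := by
        rw [← h2]
        refine Finset.sum_congr rfl fun ω hω => ?_
        have : j ∉ wd ω := (Finset.mem_filter.1 hω).2
        congr 2
        refine List.map_congr_left fun i hi => ?_
        rw [Function.update_of_ne]
        rintro rfl
        exact this hi
      rw [h3, add_zero, Finset.filter_filter] at h1
      rw [← h1]
      refine Finset.sum_congr ?_ fun _ _ => rfl
      ext ω
      simp [and_comm]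
    · intro ω hω
      have : j ∈ wd ω := (Finset.mem_filter.1 hω).2
      have h0 : (0 : R) ∈ (wd ω).map (Function.update y j 0) :=
        List.mem_map.2 ⟨j, this, by simp⟩
      rw [List.prod_eq_zero h0, smul_zero]

/-- The multilinear identity deduced from `st^m`. -/
lemma ml_of_st (d m : ℕ) (h : ∀ y : ℕ → R, st d y ^ m = 0) :
    ∃ (K : ℕ) (Ω : Type) (_ : Fintype Ω) (ε : Ω → ℤ)
    (wd : Ω → List ℕ) (ω₀ : Ω), (∀ ω, (wd ω).Perm (List.range K)) ∧ wd ω₀ = List.range K ∧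
    ε ω₀ = 1 ∧ (∀ ω, wd ω = List.range K → ω = ω₀) ∧
    ∀ y : ℕ → R, ∑ ω, ε ω • ((wd ω).map y).prod = 0 := by
  classical
  obtain ⟨Ω, _, ε, wd, h1, h2, h3⟩ := st_pow_expand (R := R) d m m
  obtain ⟨ω₁, e1, e2, e3⟩ := h3 0 (by omega)
  rw [mul_zero, ← List.range_eq_range'] at e1 e3
  have hperm : ∀ ω, (∀ j ∈ Finset.range (d * m), j ∈ wd ω) → (wd ω).Perm (List.range (d * m)) := by
    intro ω hω
    have : (List.range (d * m)).Subperm (wd ω) :=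
      List.subperm_of_subset List.nodup_range (fun j hj => hω j (by simpa using hj))
    exact (this.perm_of_length_le (by simp [h2])).symm
  have hl := linearize ε wd (fun y => by rw [← h1, h]) (Finset.range (d * m))
  refine ⟨d * m, {ω // ∀ j ∈ Finset.range (d * m), j ∈ wd ω}, inferInstance, fun ω => ε ω.1,
    fun ω => wd ω.1, ⟨ω₁, by rw [e1]; simp⟩, fun ω => hperm _ ω.2, e1, e2,
    fun ω hω => Subtype.ext (e3 _ hω), ?_⟩
  intro y
  rw [← hl y]
  symm
  apply Finset.sum_subtype
  simp

open Polynomial in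
/-- The submonoid of graded words. -/
def gS {κ : Type*} (a : κ → R) : Submonoid R[X] where
  carrier := {p | ∃ l : List κ, p = monomial l.length (l.map a).prod}
  one_mem' := ⟨[], by simp⟩
  mul_mem' := by
    rintro _ _ ⟨l, rfl⟩ ⟨l', rfl⟩
    exact ⟨l ++ l', by simp [monomial_mul_monomial]⟩

variable (k) in
/-- The span of the words of length less than `d`. -/
def Alt {κ : Type*} (a : κ → R) (d : ℕ) : Submodule k R :=
  Submodule.span k {x | ∃ l : List κ, l.length < d ∧ x = (l.map a).prod}

lemma Alt_left {κ : Type*} (a : κ → R) (d : ℕ) (w : List κ) {x : R} (hx : x ∈ Alt k a d) :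
    (w.map a).prod * x ∈ Alt k a (d + w.length) := by
  induction hx using Submodule.span_induction with
  | mem x hx =>
    obtain ⟨l, hl, rfl⟩ := hx
    refine Submodule.subset_span ⟨w ++ l, by simp; omega, by simp⟩
  | zero => simp
  | add x y _ _ hx hy => rw [mul_add]; exact add_mem hx hy
  | smul c x _ hx => rw [mul_smul_comm]; exact Submodule.smul_mem _ _ hx

lemma Alt_right {κ : Type*} (a : κ → R) (d : ℕ) (w : List κ) {x : R} (hx : x ∈ Alt k a d) :
    x * (w.map a).prod ∈ Alt k a (d + w.length) := by
  induction hx using Submodule.span_induction with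
  | mem x hx =>
    obtain ⟨l, hl, rfl⟩ := hx
    refine Submodule.subset_span ⟨l ++ w, by simp; omega, by simp⟩
  | zero => simp
  | add x y _ _ hx hy => rw [add_mul]; exact add_mem hx hy
  | smul c x _ hx => rw [smul_mul_assoc]; exact Submodule.smul_mem _ _ hx

open Polynomial

variable (k) in
/-- The polynomials whose coefficient of degree `d` is in the span of shorter words. -/
def gP {κ : Type*} (a : κ → R) : Submodule k R[X] where
  carrier := {p | ∀ d, p.coeff d ∈ Alt k a d}
  zero_mem' := by intro d; simp
  add_mem' := by
    intro p q hp hq d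
    rw [coeff_add]; exact add_mem (hp d) (hq d)
  smul_mem' := by
    intro c p hp d
    rw [coeff_smul]; exact Submodule.smul_mem _ _ (hp d)

lemma mem_gP {κ : Type*} {a : κ → R} {p : R[X]} :
    p ∈ gP k a ↔ ∀ d, p.coeff d ∈ Alt k a d := Iff.rfl

lemma gP_sId {κ : Type*} (a : κ → R) : SId (gS a) (gP k a) where
  left := by
    rintro _ ⟨l, rfl⟩ p hp e
    rw [← C_mul_X_pow_eq_monomial, mul_assoc, (commute_X_pow p l.length).eq, coeff_C_mul,
      coeff_mul_X_pow']
    split_ifs with h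
    · have := Alt_left a _ l (hp (e - l.length))
      rwa [Nat.sub_add_cancel h] at this
    · simp
  right := by
    rintro _ ⟨l, rfl⟩ p hp e
    rw [← C_mul_X_pow_eq_monomial, ← mul_assoc, coeff_mul_X_pow']
    split_ifs with h
    · have := Alt_right a _ l (hp (e - l.length))
      rw [Nat.sub_add_cancel h] at this
      rwa [coeff_mul_C]
    · simp

lemma monomial_mem_gP {κ : Type*} {a : κ → R} {d : ℕ} {x : R} :
    monomial d x ∈ gP k a ↔ x ∈ Alt k a d := by
  rw [mem_gP]
  constructor
  · intro h; simpa using h d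
  · intro h e
    rw [coeff_monomial]
    split_ifs with he
    · exact he ▸ h
    · simp

lemma map_monomial_prod {ι : Type*} (n : ι → ℕ) (b : ι → R) (w : List ι) :
    (w.map (fun i => monomial (n i) (b i))).prod = monomial (w.map n).sum (w.map b).prod := by
  induction w with
  | nil => simp
  | cons i w ih => simp [ih, monomial_mul_monomial]

lemma gS_choose {κ : Type*} {a : κ → R} {y : ℕ → R[X]} (hy : ∀ i, y i ∈ gS a) :
    ∃ (n : ℕ → ℕ) (b : ℕ → R), y = fun i => monomial (n i) (b i) := by
  choose l hl using hy
  exact ⟨fun i => (l i).length, fun i => ((l i).map a).prod, funext hl⟩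

lemma sum_transfer {Ω : Type*} [Fintype Ω] (ε : Ω → ℤ) (wd : Ω → List ℕ) (K : ℕ)
    (hp : ∀ ω, (wd ω).Perm (List.range K)) (n : ℕ → ℕ) (b : ℕ → R) :
    ∑ ω, ε ω • ((wd ω).map (fun i => monomial (n i) (b i))).prod =
      monomial ((List.range K).map n).sum (∑ ω, ε ω • ((wd ω).map b).prod) := by
  rw [_root_.map_sum]
  refine Finset.sum_congr rfl fun ω _ => ?_
  rw [map_monomial_prod, ((hp ω).map n).sum_eq, map_zsmul]

lemma st_eq (d : ℕ) (y : ℕ → R) : st d y = ∑ σ : Equiv.Perm (Fin d),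
    (Equiv.Perm.sign σ : ℤ) •
      (((List.finRange d).map (fun i => ((σ i : Fin d) : ℕ))).map y).prod := by
  simp only [List.map_map]
  rfl

lemma gS_hasML {κ : Type*} (a : κ → R) (d m : ℕ) (h : ∀ y : ℕ → R, st d y ^ m = 0) :
    HasML (gS a) := by
  obtain ⟨K, Ω, i, ε, wd, ω₀, h1, h2, h3, h4, h5⟩ := ml_of_st d m h
  refine ⟨K, Ω, i, ε, wd, ω₀, h1, h2, h3, h4, ?_⟩
  intro y hy
  obtain ⟨n, b, rfl⟩ := gS_choose hy
  rw [sum_transfer ε wd K h1, h5, map_zero]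

lemma gS_st {κ : Type*} (a : κ → R) (d m : ℕ) (h : ∀ y : ℕ → R, st d y ^ m = 0)
    (y : ℕ → R[X]) (hy : ∀ i, y i ∈ gS a) : st d y ^ m = 0 := by
  obtain ⟨n, b, rfl⟩ := gS_choose hy
  rw [st_eq, sum_transfer _ _ d perm_list, ← st_eq, monomial_pow, h, map_zero]

lemma pow_mem_Alt {κ : Type*} (a : κ → R) (l : List κ) (hl : 1 ≤ l.length)
    (hi : IsIntegral k (l.map a).prod) :
    ∃ q, (l.map a).prod ^ q ∈ Alt k a (l.length * q) := by
  obtain ⟨f, hf, he⟩ := hi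
  refine ⟨f.natDegree, ?_⟩
  rw [← aeval_def, aeval_eq_sum_range, Finset.sum_range_succ, hf.coeff_natDegree, one_smul,
    add_comm] at he
  rw [eq_neg_of_add_eq_zero_left he]
  refine neg_mem (sum_mem fun i hi => Submodule.smul_mem _ _ ?_)
  refine Submodule.subset_span ⟨(List.replicate i l).flatten, ?_, ?_⟩
  · simp only [List.length_flatten, List.map_replicate, List.sum_replicate, smul_eq_mul]
    rw [mul_comm]
    exact Nat.mul_lt_mul_of_pos_left (Finset.mem_range.1 hi) hl
  · simp [List.map_flatten, List.prod_flatten]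

lemma words_mem {κ : Type*} (a : κ → R) (D : ℕ)
    (h : ∀ l : List κ, l.length = D → (l.map a).prod ∈ Alt k a D) (N : ℕ) :
    ∀ l : List κ, l.length = N → (l.map a).prod ∈ Alt k a D := by
  induction N using Nat.strong_induction_on with
  | _ N ih =>
    intro l hl
    rcases lt_or_ge N D with hN | hN
    · exact Submodule.subset_span ⟨l, by omega, rfl⟩
    · have h1 := Alt_right a D (l.drop D) (h (l.take D) (by simp; omega))
      rw [← List.prod_append, ← List.map_append, List.take_append_drop] at h1
      refine (Submodule.span_le.2 ?_) h1
      rintro _ ⟨l', hl', rfl⟩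
      rw [List.length_drop] at hl'
      exact ih _ (by omega) l' rfl

lemma finite_of_st {κ : Type*} [Finite κ] (a : κ → R) (r m : ℕ) (hr : 1 ≤ r)
    (hst : ∀ y : ℕ → R, st (2 * r) y ^ m = 0)
    (ha : ∀ l : List κ, 1 ≤ l.length → l.length ≤ r → IsIntegral k (l.map a).prod) :
    Module.Finite k (Algebra.adjoin k (Set.range a)) := by
  have hcm : ∀ l : List κ, (l.map (fun j => (monomial 1 (a j) : R[X]))).prod =
      monomial l.length (l.map a).prod := by
    intro l
    rw [map_monomial_prod]
    simp
  obtain ⟨D, hD⟩ := core (k := k) (S := gS a) (c := fun j => monomial 1 (a j))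
    (fun j => ⟨[j], by simp⟩) (gS_hasML a _ m hst) (gP_sId a) r m hr (gS_st a _ m hst) (by
      intro l h1 h2
      obtain ⟨q, hq⟩ := pow_mem_Alt a l h1 (ha l h1 h2)
      refine ⟨q, ?_⟩
      rw [hcm, monomial_pow, monomial_mem_gP]
      exact hq)
  have hD' : ∀ l : List κ, l.length = D → (l.map a).prod ∈ Alt k a D := by
    intro l hl
    have := hD l hl
    rwa [hcm, monomial_mem_gP, hl] at this
  have hfg : (Alt k a D).FG := by
    refine Submodule.fg_span ?_
    refine ((List.finite_length_lt κ D).image (fun l => (l.map a).prod)).subset ?_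
    rintro _ ⟨l, hl, rfl⟩
    exact ⟨l, hl, rfl⟩
  have heq : Subalgebra.toSubmodule (Algebra.adjoin k (Set.range a)) = Alt k a D := by
    apply le_antisymm
    · rw [Algebra.adjoin_eq_span, Submodule.span_le]
      intro x hx
      obtain ⟨l, hl, rfl⟩ := Submonoid.exists_list_of_mem_closure hx
      have : ∃ l' : List κ, l'.map a = l := by
        have : l ∈ Set.range (List.map a) := by
          rw [Set.range_list_map]; exact hl
        exact this
      obtain ⟨l', rfl⟩ := this
      exact words_mem a D hD' _ l' rfl
    · refine Submodule.span_le.2 ?_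
      rintro _ ⟨l, _, rfl⟩
      refine Subalgebra.list_prod_mem _ ?_
      intro x hx
      obtain ⟨j, _, rfl⟩ := List.mem_map.1 hx
      exact Algebra.subset_adjoin ⟨j, rfl⟩
  rw [← heq] at hfg
  exact Module.Finite.iff_fg.2 hfg

end Core
end ShortProd

theorem adjoin_finite_of_short_products_integral
    (k A : Type*) [CommRing k] [Ring A] [Algebra k A]
    (n m : ℕ) (hn : 2 ≤ n) (hm : 1 ≤ m)
    (hid : IsPolyId k A ((stPoly k (2 * (n - 1))) ^ m))
    (t : ℕ) (a : Fin t → A)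
    (ha : ∀ l : List (Fin t), 1 ≤ l.length → l.length ≤ n - 1 →
      IsIntegral k (l.map a).prod) :
    Module.Finite k (Algebra.adjoin k (Set.range a)) := by
  refine ShortProd.finite_of_st a (n - 1) m (by omega) ?_ ha
  intro y
  have h := hid y
  rw [map_pow] at h
  rw [← h]
  congr 1
  unfold stPoly ShortProd.st
  rw [map_sum]
  refine Finset.sum_congr rfl fun σ _ => ?_
  rw [map_zsmul, map_list_prod, List.map_map]
  simp [Function.comp_def]
end

section
/- Let k be a Noetherian commutative unital ring, let m ≥ 1, and let A be a finitely generated k-algebra such that [x₁,x₂]^m is a polynomial identity of A. Then there exists m' ≥ 1 such that the product of m' commutators [x₁,x₂][x₃,x₄]⋯[x_{2m'−1},x_{2m'}] is a polynomial identity of A. -/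
namespace CP

theorem lev_step {R : Type*} [Ring R] (n : ℕ) (a : R)
    (h : ∀ y, (a * y) ^ (n + 1) * a = 0) (b g : R) (hb : b = a * g) (hbb : b * b * a = 0) (u : R) :
    (b * (a * u)) ^ n * (b * a) = 0 := by
  have hbz : ∀ z, b * (b * (a * z)) = 0 := fun z => by
    rw [← mul_assoc, ← mul_assoc, hbb, zero_mul]
  have key : ∀ (j : ℕ), b * ((b * (a * u)) ^ j * (b * a)) = 0 := by
    intro j
    cases j with
    | zero => simpa [mul_assoc] using hbb
    | succ j =>
      rw [pow_succ']
      have := hbz (u * ((b * (a * u)) ^ j * (b * a)))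
      simpa [mul_assoc] using this
  have e1 : ∀ j : ℕ, ((a * u + 1) * b) ^ (j + 1) * a = (a * u + 1) * ((b * (a * u)) ^ j * (b * a)) := by
    intro j
    induction j with
    | zero => simp [mul_assoc]
    | succ j ih =>
      rw [pow_succ', mul_assoc, ih]
      have := key j
      rw [pow_succ' (b * (a * u))]
      have e : (a * u + 1) * b * ((a * u + 1) * ((b * (a * u)) ^ j * (b * a)))
        = (a * u + 1) * (b * (a * u) * (b * (a * u)) ^ j * (b * a))
          + (a * u + 1) * (b * ((b * (a * u)) ^ j * (b * a))) := by noncomm_ring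
      rw [e, this]; simp
  have e2 : ∀ j : ℕ, ((a * u) * b) ^ (j + 1) * a = (a * u) * ((b * (a * u)) ^ j * (b * a)) := by
    intro j
    induction j with
    | zero => simp [mul_assoc]
    | succ j ih =>
      rw [pow_succ', mul_assoc, ih, pow_succ' (b * (a * u))]
      simp only [mul_assoc]
  have h1 := h (u * b + g)
  have h2 := h (u * b)
  have t1 : a * (u * b + g) = (a * u + 1) * b := by
    rw [mul_add, ← hb, add_mul, one_mul, mul_assoc]
  rw [t1, e1] at h1
  rw [← mul_assoc, e2] at h2
  rw [add_mul, h2, zero_add, one_mul] at h1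
  exact h1

theorem levitzki {R : Type*} [Ring R] (hs : ∀ a : R, (∀ y, a * y * a = 0) → a = 0) (n : ℕ) :
    ∀ a : R, (∀ y, (a * y) ^ (n + 1) * a = 0) → a = 0 := by
  induction n with
  | zero => intro a h; exact hs a (by simpa using h)
  | succ n ih =>
    intro a h
    have claim : ∀ b g : R, b = a * g → b * b * a = 0 → b * a = 0 := by
      intro b g hb hbb
      apply ih
      intro u
      have := lev_step (n + 1) a h b g hb hbb u
      rw [mul_assoc b a u]
      exact this
    have desc : ∀ (y : R) (j : ℕ), (a * y) ^ (j + 1) * a = 0 → a * y * a = 0 := by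
      intro y j
      induction j with
      | zero => intro h; simpa using h
      | succ j ihj =>
        intro h
        apply ihj
        apply claim _ (y * (a * y) ^ j)
        · rw [pow_succ']; simp only [mul_assoc]
        · rw [← pow_add]
          have : j + 1 + (j + 1) = j + (j + 1 + 1) := by ring
          rw [this, pow_add, mul_assoc, h, mul_zero]
    exact hs a fun y => desc y _ (h y)

theorem comm_of_semiprime {R : Type*} [Ring R] (hs : ∀ a : R, (∀ y, a * y * a = 0) → a = 0)
    (m : ℕ) (h : ∀ x y : R, (x * y - y * x) ^ m = 0) (x y : R) : x * y - y * x = 0 := by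
  have sq : ∀ a : R, a * a = 0 → a = 0 := by
    intro a ha
    apply levitzki hs m
    intro y
    have e : ∀ j : ℕ, (a * y - y * a) ^ j * a = (a * y) ^ j * a := by
      intro j
      induction j with
      | zero => simp
      | succ j ih =>
        rw [pow_succ', mul_assoc, ih, pow_succ', sub_mul]
        have : y * a * ((a * y) ^ j * a) = 0 := by
          cases j with
          | zero => simp [mul_assoc, ha]
          | succ j =>
            rw [pow_succ']
            have : y * a * (a * y * (a * y) ^ j * a) = y * (a * a) * (y * (a * y) ^ j * a) := by
              simp only [mul_assoc]
            rw [this, ha]; simp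
        rw [this, sub_zero, ← mul_assoc]
    rw [pow_succ', mul_assoc, ← e, h]; simp
  have red : ∀ (j : ℕ) (a : R), a ^ (j + 1) = 0 → a = 0 := by
    intro j
    induction j with
    | zero => intro a h; simpa using h
    | succ j ih =>
      intro a h
      apply ih
      apply sq
      rw [← pow_add, show j + 1 + (j + 1) = j + (j + 1 + 1) by ring, pow_add, h, mul_zero]
  apply red m
  rw [pow_succ, h, zero_mul]

theorem nil_of_commutator {R : Type*} [Ring R] (m : ℕ) (h : ∀ x y : R, (x * y - y * x) ^ m = 0)
    (u a b v : R) : ∃ n : ℕ, (u * (a * b - b * a) * v) ^ n = 0 := by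
  set w := u * (a * b - b * a) * v with hw
  by_contra hcon
  push Not at hcon
  obtain ⟨P, -, hP⟩ := zorn_le_nonempty₀ {P : TwoSidedIdeal R | ∀ n : ℕ, w ^ n ∉ P} (by
    intro c hc hchain Q hQ
    refine ⟨sSup c, ?_, fun z hz => le_sSup hz⟩
    intro n hn
    have key : ∃ I ∈ c, w ^ n ∈ I := by
      let S : TwoSidedIdeal R := TwoSidedIdeal.mk' {x | ∃ I ∈ c, x ∈ I}
        ⟨Q, hQ, Q.zero_mem⟩
        (by
          rintro x y ⟨I, hI, hx⟩ ⟨J, hJ, hy⟩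
          rcases hchain.total hI hJ with hle | hle
          · exact ⟨J, hJ, J.add_mem (hle hx) hy⟩
          · exact ⟨I, hI, I.add_mem hx (hle hy)⟩)
        (by rintro x ⟨I, hI, hx⟩; exact ⟨I, hI, I.neg_mem hx⟩)
        (by rintro x y ⟨I, hI, hx⟩; exact ⟨I, hI, I.mul_mem_left _ _ hx⟩)
        (by rintro x y ⟨I, hI, hx⟩; exact ⟨I, hI, I.mul_mem_right _ _ hx⟩)
      have hle : sSup c ≤ S := sSup_le (by
        intro I hI x hx
        rw [TwoSidedIdeal.mem_mk']
        exact ⟨I, hI, hx⟩)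
      have := hle hn
      rw [TwoSidedIdeal.mem_mk'] at this
      exact this
    obtain ⟨I, hI, hx⟩ := key
    exact hc hI n hx) ⊥ (by
      intro n hn
      rw [TwoSidedIdeal.mem_bot] at hn
      exact hcon n hn)
  have hPn : ∀ n : ℕ, w ^ n ∉ P := hP.prop
  have hsemi : ∀ a : R, (∀ y, a * y * a ∈ P) → a ∈ P := by
    intro a ha
    by_contra haP
    let P' := P ⊔ TwoSidedIdeal.span {a}
    have hlt : ¬ (P' ≤ P) := fun hle => haP (hle ((le_sup_right : _ ≤ P')
      (TwoSidedIdeal.subset_span rfl)))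
    have hex : ∃ n, w ^ n ∈ P' := by
      by_contra hno
      push Not at hno
      exact hlt (hP.le_of_ge hno le_sup_left)
    obtain ⟨n, hn⟩ := hex
    have ind : ∀ S : TwoSidedIdeal R, P ≤ S → a ∈ S → P' ≤ S := fun S h1 h2 =>
      sup_le h1 (TwoSidedIdeal.span_le.2 (by simpa using h2))
    have s1 : ∀ x ∈ P', ∀ r, a * r * x ∈ P := by
      let S : TwoSidedIdeal R := TwoSidedIdeal.mk' {x | ∀ r, a * r * x ∈ P}
        (by intro r; simp [P.zero_mem])
        (by intro x y hx hy r; rw [mul_add]; exact P.add_mem (hx r) (hy r))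
        (by intro x hx r; rw [mul_neg]; exact P.neg_mem (hx r))
        (by intro x y hy r; have := hy (r * x); simpa [mul_assoc] using this)
        (by intro x y hx r; rw [← mul_assoc]; exact P.mul_mem_right _ _ (hx r))
      intro x hx
      have := ind S (by intro z hz; rw [TwoSidedIdeal.mem_mk']; intro r; exact P.mul_mem_left _ _ hz)
        (by rw [TwoSidedIdeal.mem_mk']; exact ha) hx
      rw [TwoSidedIdeal.mem_mk'] at this
      exact this
    have s2 : ∀ x ∈ P', ∀ r, ∀ z ∈ P', x * r * z ∈ P := by
      let S : TwoSidedIdeal R := TwoSidedIdeal.mk' {x | ∀ r, ∀ z ∈ P', x * r * z ∈ P}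
        (by intro r z hz; simp [P.zero_mem])
        (by intro x y hx hy r z hz; rw [add_mul, add_mul]; exact P.add_mem (hx r z hz) (hy r z hz))
        (by intro x hx r z hz; rw [neg_mul, neg_mul]; exact P.neg_mem (hx r z hz))
        (by intro x y hy r z hz; rw [mul_assoc x, mul_assoc x]; exact P.mul_mem_left _ _ (hy r z hz))
        (by intro x y hx r z hz; rw [mul_assoc x]; exact hx _ z hz)
      intro x hx
      have := ind S (by
          intro z hz; rw [TwoSidedIdeal.mem_mk']; intro r t _
          exact P.mul_mem_right _ _ (P.mul_mem_right _ _ hz))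
        (by rw [TwoSidedIdeal.mem_mk']; exact fun r z hz => s1 z hz r) hx
      rw [TwoSidedIdeal.mem_mk'] at this
      exact this
    have := s2 _ hn 1 _ hn
    rw [mul_one, ← pow_add] at this
    exact hPn _ this
  let f := P.ringCon.mk'
  have hf : Function.Surjective f := P.ringCon.mk'_surjective
  have hf0 : ∀ x, f x = 0 ↔ x ∈ P := by
    intro x
    have := TwoSidedIdeal.mem_ker (f := f) (x := x)
    rw [TwoSidedIdeal.ker_ringCon_mk' P] at this
    exact this.symm
  have hc := comm_of_semiprime (R := P.ringCon.Quotient)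
    (by
      intro x hx
      obtain ⟨x, rfl⟩ := hf x
      rw [hf0]
      apply hsemi
      intro y
      rw [← hf0, map_mul, map_mul]; exact hx _) m
    (by
      intro x y
      obtain ⟨x, rfl⟩ := hf x
      obtain ⟨y, rfl⟩ := hf y
      rw [← map_mul, ← map_mul, ← map_sub, ← map_pow, h, map_zero]) (f a) (f b)
  rw [← map_mul, ← map_mul, ← map_sub, hf0] at hc
  apply hPn 1
  rw [pow_one]
  exact P.mul_mem_right _ _ (P.mul_mem_left _ _ hc)

end CP

namespace CP

theorem polar_multi {M N : Type*} [AddCommGroup M] [AddCommGroup N] (m : ℕ)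
    (F : MultilinearMap ℤ (fun _ : Fin m => M) N) (h : ∀ v : M, F (fun _ => v) = 0)
    (v : Fin m → M) : ∑ σ : Equiv.Perm (Fin m), F (fun i => v (σ i)) = 0 := by
  classical
  have h1 : ∑ S : Finset (Fin m), (-1 : ℤ) ^ S.card • F (fun _ => ∑ i ∈ S, v i) = 0 :=
    Finset.sum_eq_zero fun S _ => by rw [h, smul_zero]
  have h2 : ∀ S : Finset (Fin m), F (fun _ => ∑ i ∈ S, v i)
      = ∑ f : Fin m → Fin m, if (∀ i, f i ∈ S) then F (fun i => v (f i)) else 0 := by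
    intro S
    rw [MultilinearMap.map_sum_finset F (fun _ j => v j) (fun _ => S), ← Finset.sum_filter]
    apply Finset.sum_congr _ (fun _ _ => rfl)
    ext f; simp [Fintype.mem_piFinset]
  simp only [h2, Finset.smul_sum] at h1
  rw [Finset.sum_comm] at h1
  have h3 : ∀ f : Fin m → Fin m,
      (∑ S : Finset (Fin m), (-1 : ℤ) ^ S.card •
        (if (∀ i, f i ∈ S) then F (fun i => v (f i)) else 0))
      = if Function.Bijective f then (-1 : ℤ) ^ m • F (fun i => v (f i)) else 0 := by
    intro f
    split_ifs with hf
    · rw [Finset.sum_eq_single Finset.univ]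
      · simp
      · intro S _ hS
        rw [if_neg, smul_zero]
        intro hall
        apply hS
        ext j
        obtain ⟨i, rfl⟩ := hf.2 j
        simp [hall]
      · simp
    · have hns : ¬ Function.Surjective f := fun hs => hf (Finite.surjective_iff_bijective.1 hs)
      unfold Function.Surjective at hns
      push Not at hns
      obtain ⟨j, hj⟩ := hns
      apply Finset.sum_involution (fun S _ => if j ∈ S then S.erase j else insert j S)
      · intro S _
        have hiff : (∀ i, f i ∈ (if j ∈ S then S.erase j else insert j S)) ↔ ∀ i, f i ∈ S := by
          split_ifs <;> simp [hj]
        rw [if_congr hiff rfl rfl, ← add_smul]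
        convert zero_smul ℤ _
        split_ifs with hjS
        · have := Finset.card_erase_add_one hjS
          rw [← this, pow_succ]; ring
        · rw [Finset.card_insert_of_notMem hjS, pow_succ]; ring
      · intro S _ _
        split_ifs with hjS
        · intro e; rw [← e] at hjS; simp at hjS
        · intro e; rw [← e] at hjS; simp at hjS
      · intro S _
        by_cases hjS : j ∈ S
        · simp [hjS]
        · simp [hjS]
      · intro S _; exact Finset.mem_univ _
  simp only [h3] at h1
  rw [← Finset.sum_filter, ← Finset.smul_sum] at h1
  have h4 : ∑ f : Fin m → Fin m with Function.Bijective f, F (fun i => v (f i)) = 0 := by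
    rcases neg_one_pow_eq_or ℤ m with e | e <;> rw [e] at h1 <;> simpa using h1
  rw [← h4]
  refine Finset.sum_bij (fun σ _ => ⇑σ) ?_ ?_ ?_ ?_
  · intro σ _; exact Finset.mem_filter.2 ⟨Finset.mem_univ _, σ.bijective⟩
  · intro σ _ τ _ e; exact DFunLike.coe_injective e
  · intro f hf
    simp only [Finset.mem_filter, Finset.mem_univ, true_and] at hf
    exact ⟨Equiv.ofBijective f hf, Finset.mem_univ _, rfl⟩
  · intros; rfl

/-- The commutator map as a linear map in the second variable. -/
def adL {A : Type*} [Ring A] (x : A) : A →ₗ[ℤ] A := LinearMap.mulLeft ℤ x - LinearMap.mulRight ℤ x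

theorem polar_comm {A : Type*} [Ring A] (m : ℕ) (h : ∀ x y : A, (x * y - y * x) ^ m = 0)
    (x y : Fin m → A) : ∑ τ : Equiv.Perm (Fin m), ∑ σ : Equiv.Perm (Fin m),
      (List.ofFn fun i => x (σ i) * y (τ i) - y (τ i) * x (σ i)).prod = 0 := by
  have h1 : ∀ v : A, ∑ σ : Equiv.Perm (Fin m),
      (List.ofFn fun i => x (σ i) * v - v * x (σ i)).prod = 0 := by
    intro v
    have := polar_multi m ((MultilinearMap.mkPiAlgebraFin ℤ m A).compLinearMap
      (fun _ => - adL v)) (by intro u; simp [adL, h]) x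
    simpa [adL] using this
  have := polar_multi m (∑ σ : Equiv.Perm (Fin m),
    (MultilinearMap.mkPiAlgebraFin ℤ m A).compLinearMap (fun i => adL (x (σ i))))
    (by intro u; simpa [adL, sum_apply] using h1 u) y
  simpa [adL, sum_apply] using this

end CP

namespace CP

section comb

variable {X : Type*}

/-- Strict lexicographic comparison at a genuine difference. -/
def Prec [LinearOrder X] (a b : List X) : Prop :=
  ∃ q x y r s, x < y ∧ a = q ++ x :: r ∧ b = q ++ y :: s

theorem Prec.mono [LinearOrder X] {a b a' b' : List X} (h : Prec a b) (ha : a <+: a')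
    (hb : b <+: b') : Prec a' b' := by
  obtain ⟨q, x, y, r, s, hxy, rfl, rfl⟩ := h
  obtain ⟨t, rfl⟩ := ha
  obtain ⟨t', rfl⟩ := hb
  exact ⟨q, x, y, r ++ t, s ++ t', hxy, by simp, by simp⟩

theorem Prec.app [LinearOrder X] {a b : List X} (h : Prec a b) (p : List X) :
    Prec (p ++ a) (p ++ b) := by
  obtain ⟨q, x, y, r, s, hxy, rfl, rfl⟩ := h
  exact ⟨p ++ q, x, y, r, s, hxy, by simp, by simp⟩

theorem Prec.lt [LinearOrder X] {a b : List X} (h : Prec a b) : a < b := by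
  obtain ⟨q, x, y, r, s, hxy, rfl, rfl⟩ := h
  induction q with
  | nil => exact List.Lex.rel hxy
  | cons z q ih => exact List.Lex.cons ih

theorem prec_total [LinearOrder X] (a b : List X) (h1 : ¬ a <+: b) (h2 : ¬ b <+: a) :
    Prec a b ∨ Prec b a := by
  induction a generalizing b with
  | nil => exact absurd (List.nil_prefix) h1
  | cons x a ih =>
    cases b with
    | nil => exact absurd (List.nil_prefix) h2
    | cons y b =>
      rcases lt_trichotomy x y with h | h | h
      · exact Or.inl ⟨[], x, y, a, b, h, rfl, rfl⟩
      · subst h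
        rw [List.prefix_cons_inj] at h1 h2
        rcases ih b h1 h2 with h | h
        · exact Or.inl (h.app [x])
        · exact Or.inr (h.app [x])
      · exact Or.inr ⟨[], y, x, b, a, h, rfl, rfl⟩

theorem flatten_prec [LinearOrder X] (L L' : List (List X)) (hp : L'.Perm L)
    (hs : L.Pairwise (fun a b => Prec b a)) (hne : L' ≠ L) : Prec L'.flatten L.flatten := by
  induction L generalizing L' with
  | nil => exact absurd hp.eq_nil hne
  | cons a t ih =>
    cases L' with
    | nil => exact absurd hp.symm.eq_nil (by simp)
    | cons b t' =>
      rw [List.pairwise_cons] at hs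
      by_cases hab : b = a
      · subst hab
        rw [List.perm_cons] at hp
        have := ih t' hp hs.2 (by rintro rfl; exact hne rfl)
        simpa using this.app b
      · have hb : b ∈ a :: t := hp.mem_iff.1 (by simp)
        have hb' : b ∈ t := by simpa [hab] using hb
        exact (hs.1 b hb').mono (by simp) (by simp)

/-- `w` has `n` disjoint occurrences of `B`. -/
def Occ (B : List X) : ℕ → List X → Prop
  | 0, _ => True
  | n + 1, w => ∃ p g, w = p ++ B ++ g ∧ Occ B n g

theorem Occ.prepend {B : List X} {n : ℕ} {w : List X} (h : Occ B n w) (p : List X) :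
    Occ B n (p ++ w) := by
  cases n with
  | zero => trivial
  | succ n =>
    obtain ⟨q, g, rfl, hg⟩ := h
    exact ⟨p ++ q, g, by simp, hg⟩

theorem Occ.mono {B : List X} {n n' : ℕ} {w : List X} (h : Occ B n w) (hn : n' ≤ n) :
    Occ B n' w := by
  induction n' generalizing n w with
  | zero => trivial
  | succ n' ih =>
    cases n with
    | zero => omega
    | succ n =>
      obtain ⟨q, g, rfl, hg⟩ := h
      exact ⟨q, g, rfl, ih hg (by omega)⟩

theorem split_count (c : X → Bool) (w : List X) (l : ℕ) (h : l + 1 ≤ w.countP c) :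
    ∃ q x w', w = q ++ x :: w' ∧ c x = true ∧ q.countP c = l := by
  induction w generalizing l with
  | nil => simp at h
  | cons y w ih =>
    by_cases hy : c y = true
    · cases l with
      | zero => exact ⟨[], y, w, rfl, hy, rfl⟩
      | succ l =>
        rw [List.countP_cons_of_pos hy] at h
        obtain ⟨q, x, w', rfl, hx, hq⟩ := ih l (by omega)
        exact ⟨y :: q, x, w', rfl, hx, by rw [List.countP_cons_of_pos hy, hq]⟩
    · rw [List.countP_cons_of_neg hy] at h
      obtain ⟨q, x, w', rfl, hx, hq⟩ := ih l h
      exact ⟨y :: q, x, w', rfl, hx, by rw [List.countP_cons_of_neg hy, hq]⟩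

theorem block_split (c : X → Bool) (w : List X) (l : ℕ) (h : l + 1 ≤ w.countP c) :
    ∃ p B x w', w = p ++ (B ++ [x]) ++ w' ∧ c x = true ∧ B.length = l ∧
      w'.countP c + (l + 1) = w.countP c := by
  obtain ⟨q, x, w', rfl, hx, hq⟩ := split_count c w l h
  have hl : l ≤ q.length := hq ▸ List.countP_le_length
  refine ⟨q.take (q.length - l), q.drop (q.length - l), x, w', ?_, hx, ?_, ?_⟩
  · rw [← List.append_assoc, List.take_append_drop]; simp
  · simp; omega
  · rw [List.countP_append, List.countP_cons_of_pos hx, hq]; omega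

theorem many_blocks [Fintype X] [DecidableEq X] (c : X → Bool) (l K : ℕ) (w : List X)
    (h : K * (l + 1) ≤ w.countP c) :
    ∃ f : (List.Vector X l × X) → ℕ, ∑ b, f b = K ∧
      ∀ b, f b ≠ 0 → c b.2 = true ∧ Occ (b.1.1 ++ [b.2]) (f b) w := by
  induction K generalizing w with
  | zero => exact ⟨fun _ => 0, by simp, fun b hb => absurd rfl hb⟩
  | succ K ih =>
    obtain ⟨p, B, x, w', rfl, hx, hB, hc⟩ := block_split c w l (by
      rw [Nat.succ_mul] at h; omega)
    obtain ⟨f, hf, hocc⟩ := ih w' (by rw [Nat.succ_mul] at h; omega)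
    refine ⟨fun b => f b + if b = (⟨B, hB⟩, x) then 1 else 0, ?_, ?_⟩
    · rw [Finset.sum_add_distrib, hf]; simp
    · intro b hb
      by_cases hbe : b = (⟨B, hB⟩, x)
      · subst hbe
        refine ⟨hx, ?_⟩
        simp only [if_true]
        refine ⟨p, w', rfl, ?_⟩
        by_cases h0 : f (⟨B, hB⟩, x) = 0
        · rw [h0]; trivial
        · exact (hocc _ h0).2
      · simp only [hbe, if_false, add_zero] at hb ⊢
        exact ⟨(hocc b hb).1, (hocc b hb).2.prepend _⟩

theorem occ_decomp [LinearOrder X] (B : List X) (Ss : List (List X))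
    (hS : ∀ S ∈ Ss, S <:+ B) (hp : Ss.Pairwise (fun a b => Prec b a)) (w : List X)
    (h : Occ B Ss.length w) :
    ∃ r Ws, w = r ++ List.flatten Ws ∧ Ws.length = Ss.length ∧
      Ws.Pairwise (fun a b => Prec b a) ∧ ∀ W ∈ Ws, ∃ S ∈ Ss, S <+: W := by
  induction Ss generalizing w with
  | nil => exact ⟨w, [], by simp, rfl, List.Pairwise.nil, by simp⟩
  | cons S Ss ih =>
    obtain ⟨p, g, rfl, hg⟩ := h
    rw [List.pairwise_cons] at hp
    obtain ⟨r, Ws, rfl, hlen, hpw, hpre⟩ := ih (fun T hT => hS T (by simp [hT])) hp.2 g hg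
    obtain ⟨t, rfl⟩ := hS S (by simp)
    refine ⟨p ++ t, (S ++ r) :: Ws, by simp, by simp [hlen], ?_, ?_⟩
    · rw [List.pairwise_cons]
      refine ⟨?_, hpw⟩
      intro W hW
      obtain ⟨T, hT, hTW⟩ := hpre W hW
      exact (hp.1 T hT).mono hTW (by simp)
    · intro W hW
      rcases List.mem_cons.1 hW with rfl | hW
      · exact ⟨S, by simp, by simp⟩
      · obtain ⟨T, hT, hTW⟩ := hpre W hW
        exact ⟨T, by simp [hT], hTW⟩

theorem periodic (M : ℕ) (e x u : List X) (h : e ++ x = x ++ u) (hl : u.length * M ≤ x.length) :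
    ∃ α, x = α ++ (List.replicate M u).flatten := by
  induction M generalizing x with
  | zero => exact ⟨x, by simp⟩
  | succ M ih =>
    rw [Nat.mul_succ] at hl
    have hux : u <:+ x := by
      have h1 : u <:+ e ++ x := h ▸ List.suffix_append _ _
      exact List.suffix_of_suffix_length_le h1 (List.suffix_append _ _) (by omega)
    obtain ⟨x', rfl⟩ := hux
    have h' : e ++ x' = x' ++ u := by
      rw [← List.append_assoc] at h
      exact List.append_cancel_right h
    obtain ⟨α, hα⟩ := ih x' h' (by simp at hl; omega)
    refine ⟨α, ?_⟩
    rw [List.replicate_succ', List.flatten_append, ← List.append_assoc, ← hα]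
    simp

theorem comb [Fintype X] [LinearOrder X] (c : X → Bool) (d M : ℕ) :
    ∃ N : ℕ, ∀ w : List X, N ≤ w.countP c →
      (∃ r Ws, w = r ++ List.flatten Ws ∧ Ws.length = d ∧ Ws.Pairwise (fun a b => Prec b a)) ∨
      (∃ α u β, w = α ++ (List.replicate M u).flatten ++ β ∧ u.length ≤ d ∧
        ∃ x ∈ u, c x = true) := by
  rcases Nat.eq_zero_or_pos d with rfl | hd
  · exact ⟨0, fun w _ => Or.inl ⟨w, [], by simp, rfl, List.Pairwise.nil⟩⟩
  set l := d * M + d - 1 with hl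
  refine ⟨(Fintype.card (List.Vector X l × X) * d + 1) * (l + 1), fun w hw => ?_⟩
  obtain ⟨f, hf, hocc⟩ := many_blocks c l _ w hw
  obtain ⟨b, hb⟩ : ∃ b, d ≤ f b := by
    by_contra hno
    push Not at hno
    have : ∑ b, f b ≤ Fintype.card (List.Vector X l × X) * d := by
      have := Finset.sum_le_card_nsmul Finset.univ f d (fun b _ => (hno b).le)
      simpa using this
    omega
  obtain ⟨hcx, ho⟩ := hocc b (by omega)
  have ho := ho.mono hb
  obtain ⟨⟨B0, hB0⟩, x⟩ := b
  simp only at hcx ho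
  set B := B0 ++ [x] with hB
  have hBl : B.length = d * M + d := by simp [hB, hB0]; omega
  by_cases hpre : ∃ i j, i < j ∧ j < d ∧ B.drop j <+: B.drop i
  · right
    obtain ⟨i, j, hij, hj, u, hu⟩ := hpre
    have hdd : B.drop i = (B.drop i).take (j - i) ++ B.drop j := by
      conv_lhs => rw [← List.take_append_drop (j - i) (B.drop i)]
      rw [List.drop_drop]
      congr 2
      omega
    have hlen : u.length = j - i := by
      have := congrArg List.length hu
      simp at this
      omega
    have hul : u.length * M ≤ d * M := Nat.mul_le_mul_right _ (by omega)
    obtain ⟨α, hα⟩ := periodic M _ _ _ (hdd.symm.trans hu.symm) (by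
      rw [List.length_drop, hBl]
      omega)
    have hux : u <:+ B := by
      have h1 : u <:+ B.drop i := hu ▸ List.suffix_append _ _
      exact h1.trans (List.drop_suffix _ _)
    have hxu : x ∈ u := by
      have h1 : [x] <:+ B := hB ▸ List.suffix_append _ _
      have h2 : [x] <:+ u := List.suffix_of_suffix_length_le h1 hux (by simp; omega)
      exact h2.mem (by simp)
    have ho1 := ho.mono (show 1 ≤ d from hd)
    obtain ⟨p, g, hw', -⟩ := ho1
    refine ⟨p ++ B.take j ++ α, u, g, ?_, by omega, x, hxu, hcx⟩
    rw [hw']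
    conv_lhs => rw [← List.take_append_drop j B, hα]
    simp
  · left
    push Not at hpre
    have hnp : ∀ i j, i < d → j < d → i ≠ j → ¬ (B.drop i <+: B.drop j) := by
      intro i j hi hj hij hp
      rcases lt_or_gt_of_ne hij with h | h
      · have := hp.length_le
        simp at this
        omega
      · exact hpre j i h hi hp
    let Ss := ((Finset.range d).image (fun i => B.drop i)).sort (· ≥ ·)
    have hlen : Ss.length = d := by
      rw [Finset.length_sort, Finset.card_image_of_injOn, Finset.card_range]
      intro i hi j hj hij
      simp only [Finset.coe_range, Set.mem_Iio] at hi hj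
      by_contra hne
      exact hnp i j hi hj hne (by simp only at hij; rw [hij])
    have hmem : ∀ S ∈ Ss, ∃ i < d, B.drop i = S := by
      intro S hS
      simpa [Ss] using hS
    have hpw : Ss.Pairwise (fun a b => Prec b a) := by
      have hsort : Ss.Pairwise (fun a b => a > b) := Finset.sortedGT_sort _ |>.pairwise
      refine hsort.imp_of_mem ?_
      intro a b ha hb hab
      obtain ⟨i, hi, rfl⟩ := hmem a ha
      obtain ⟨j, hj, rfl⟩ := hmem b hb
      have hne : i ≠ j := by rintro rfl; exact lt_irrefl _ hab
      rcases prec_total _ _ (hnp i j hi hj hne) (hnp j i hj hi hne.symm) with h | h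
      · exact absurd h.lt (lt_asymm hab)
      · exact h
    obtain ⟨r, Ws, h1, h2, h3, -⟩ := occ_decomp B Ss (by
      intro S hS
      obtain ⟨i, -, rfl⟩ := hmem S hS
      exact List.drop_suffix _ _) hpw w (by rw [hlen]; exact ho)
    exact ⟨r, Ws, h1, h2.trans hlen, h3⟩

end comb

end CP

namespace CP

/-- `Flip P L`: `L` lists the entries of the pairs in `P`, each pair in one of the two orders. -/
inductive Flip {W : Type*} : List (W × W) → List W → Prop
  | nil : Flip [] []
  | same (a b : W) {P L} : Flip P L → Flip ((a, b) :: P) (a :: b :: L)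
  | swap (a b : W) {P L} : Flip P L → Flip ((a, b) :: P) (b :: a :: L)

/-- Concatenation of pairs. -/
def flat {W : Type*} : List (W × W) → List W
  | [] => []
  | q :: P => q.1 :: q.2 :: flat P

theorem flat_perm {W : Type*} (P : List (W × W)) :
    (flat P).Perm (P.map Prod.fst ++ P.map Prod.snd) := by
  induction P with
  | nil => simp [flat]
  | cons q P ih =>
    simp only [flat, List.map_cons, List.cons_append, List.perm_cons]
    exact (ih.cons _).trans List.perm_middle.symm

theorem Flip.perm {W : Type*} {P : List (W × W)} {L : List W} (h : Flip P L) :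
    L.Perm (flat P) := by
  induction h with
  | nil => exact List.Perm.refl _
  | same a b _ ih => exact (ih.cons _).cons _
  | swap a b _ ih => exact (List.Perm.swap _ _ _).trans ((ih.cons _).cons _)

theorem Flip.eq_flat {W : Type*} {P : List (W × W)} {L : List W} (h : Flip P L)
    (P' : List (W × W)) (hL : L = flat P') :
    List.Forall₂ (fun q q' => q' = q ∨ q' = q.swap) P P' := by
  induction h generalizing P' with
  | nil =>
    cases P' with
    | nil => exact List.Forall₂.nil
    | cons q P' => simp [flat] at hL
  | same a b _ ih =>
    cases P' with
    | nil => simp [flat] at hL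
    | cons q P' =>
      simp only [flat, List.cons.injEq] at hL
      exact List.Forall₂.cons (Or.inl (by rw [hL.1, hL.2.1])) (ih P' hL.2.2)
  | swap a b _ ih =>
    cases P' with
    | nil => simp [flat] at hL
    | cons q P' =>
      simp only [flat, List.cons.injEq] at hL
      exact List.Forall₂.cons (Or.inr (by rw [hL.1, hL.2.1]; rfl)) (ih P' hL.2.2)

theorem flip_zero {W A : Type*} [Ring A] (E : W → A) (P : List (W × W)) (p : A)
    (h : ∀ L, Flip P L → p * (L.map E).prod = 0) :
    p * (P.map (fun q => E q.1 * E q.2 - E q.2 * E q.1)).prod = 0 := by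
  induction P generalizing p with
  | nil => simpa using h [] Flip.nil
  | cons q P ih =>
    obtain ⟨a, b⟩ := q
    have h1 := ih (p * E a * E b) (fun L hL => by
      simpa [mul_assoc] using h _ (Flip.same a b hL))
    have h2 := ih (p * E b * E a) (fun L hL => by
      simpa [mul_assoc] using h _ (Flip.swap a b hL))
    rw [List.map_cons, List.prod_cons, ← mul_assoc, mul_sub, sub_mul, ← mul_assoc, ← mul_assoc,
      h1, h2, sub_zero]

theorem flip_main {W A : Type*} [Ring A] (E : W → A) (P : List (W × W)) (p : A)
    (hP : ∀ q ∈ P, q.1 ≠ q.2)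
    (h : ∀ L, Flip P L → L ≠ flat P → p * (L.map E).prod = 0) :
    p * (P.map (fun q => E q.1 * E q.2 - E q.2 * E q.1)).prod = p * ((flat P).map E).prod := by
  induction P generalizing p with
  | nil => simp [flat]
  | cons q P ih =>
    have hq := hP q (by simp)
    obtain ⟨a, b⟩ := q
    have h1 := ih (p * E a * E b) (fun q hq => hP q (by simp [hq])) (fun L hL hne => by
      simpa [mul_assoc] using h _ (Flip.same a b hL) (by simpa [flat] using hne))
    have h2 := flip_zero E P (p * E b * E a) (fun L hL => by
      simpa [mul_assoc] using h _ (Flip.swap a b hL) (by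
        simp only [flat, ne_eq, List.cons.injEq, not_and]
        intro e; exact absurd e.symm hq))
    rw [List.map_cons, List.prod_cons, ← mul_assoc, mul_sub, sub_mul, ← mul_assoc, ← mul_assoc,
      h1, h2, sub_zero]
    simp [flat, mul_assoc]

theorem exists_pairs {W : Type*} (m : ℕ) (Ws : List W) (h : Ws.length = 2 * m) :
    ∃ x y : Fin m → W, Ws = flat (List.ofFn fun i => (x i, y i)) := by
  induction m generalizing Ws with
  | zero => exact ⟨Fin.elim0, Fin.elim0, by simpa [flat] using h⟩
  | succ m ih =>
    match Ws, h with
    | a :: b :: Ws, h =>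
      obtain ⟨x, y, hxy⟩ := ih Ws (by simp at h; omega)
      refine ⟨Fin.cons a x, Fin.cons b y, ?_⟩
      rw [List.ofFn_succ]
      simp [flat, hxy]
    | [a], h => simp at h; omega
    | [], h => simp at h

theorem apply_identity {W A : Type*} [Ring A] (m : ℕ) (hid : ∀ x y : A, (x * y - y * x) ^ m = 0)
    (E : W → A) (p : A) (Ws : List W) (hlen : Ws.length = 2 * m) (hnd : Ws.Nodup)
    (h : ∀ L, L.Perm Ws → L ≠ Ws → p * (L.map E).prod = 0) : p * (Ws.map E).prod = 0 := by
  obtain ⟨x, y, rfl⟩ := exists_pairs m Ws hlen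
  have hnd' := (flat_perm _).nodup_iff.1 hnd
  simp only [List.map_ofFn] at hnd'
  rw [List.nodup_append] at hnd'
  obtain ⟨hx, hy, hxy⟩ := hnd'
  have hxy' : ∀ i j, x i ≠ y j := by
    intro i j
    exact hxy _ (by simp [List.mem_ofFn]) _ (by simp [List.mem_ofFn])
  have hxi : Function.Injective x := List.nodup_ofFn.1 hx
  have hyi : Function.Injective y := List.nodup_ofFn.1 hy
  have hpol := polar_comm m hid (fun i => E (x i)) (fun i => E (y i))
  have hz : ∀ τ σ : Equiv.Perm (Fin m), ¬ (τ = 1 ∧ σ = 1) →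
      p * (List.ofFn fun i => E (x (σ i)) * E (y (τ i)) - E (y (τ i)) * E (x (σ i))).prod = 0 := by
    intro τ σ hne
    have := flip_zero E (List.ofFn fun i => (x (σ i), y (τ i))) p (by
      intro L hL
      apply h
      · refine hL.perm.trans ((flat_perm _).trans (List.Perm.trans ?_ (flat_perm _).symm))
        simp only [List.map_ofFn]
        exact (Equiv.Perm.ofFn_comp_perm σ x).append (Equiv.Perm.ofFn_comp_perm τ y)
      · intro e
        have h2 := hL.eq_flat _ e
        rw [List.forall₂_iff_get] at h2
        have h3 : ∀ i : Fin m, x (σ i) = x i ∧ y (τ i) = y i := by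
          intro i
          have := h2.2 i (by simp) (by simp)
          simp only [List.get_eq_getElem, List.getElem_ofFn, Prod.swap_prod_mk, Prod.mk.injEq] at this
          rcases this with h | h
          · exact ⟨h.1.symm, h.2.symm⟩
          · exact absurd h.1 (hxy' _ _)
        apply hne
        constructor
        · ext i; exact congrArg _ (hyi (h3 i).2)
        · ext i; exact congrArg _ (hxi (h3 i).1))
    simpa [List.map_ofFn, Function.comp_def] using this
  have hmain := flip_main E (List.ofFn fun i => (x i, y i)) p (by
      intro q hq
      rw [List.mem_ofFn] at hq
      obtain ⟨i, rfl⟩ := hq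
      exact hxy' i i) (fun L hL hne => h L hL.perm hne)
  rw [← hmain]
  have e : p * ∑ τ : Equiv.Perm (Fin m), ∑ σ : Equiv.Perm (Fin m),
      (List.ofFn fun i => E (x (σ i)) * E (y (τ i)) - E (y (τ i)) * E (x (σ i))).prod = 0 := by
    rw [hpol, mul_zero]
  rw [Finset.mul_sum, Finset.sum_eq_single 1, Finset.mul_sum, Finset.sum_eq_single 1] at e
  · simpa [List.map_ofFn, Function.comp_def] using e
  · intro σ _ hσ; exact hz 1 σ (fun h => hσ h.2)
  · simp
  · intro τ _ hτ
    rw [Finset.mul_sum]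
    exact Finset.sum_eq_zero fun σ _ => hz τ σ (fun h => hτ h.1)
  · simp

theorem words_zero {X A : Type*} [Finite X] [Ring A] (m : ℕ)
    (hid : ∀ x y : A, (x * y - y * x) ^ m = 0) (φ : X → A) (c : X → Bool)
    (hc : ∀ x, c x = true → ∃ a b : A, φ x = a * b - b * a) :
    ∃ N : ℕ, ∀ w : List X, N ≤ w.countP c → (w.map φ).prod = 0 := by
  classical
  have := Fintype.ofFinite X
  letI : LinearOrder X := linearOrderOfSTO WellOrderingRel
  have hnil : ∀ u : List X, (∃ x ∈ u, c x = true) → ∃ n : ℕ, (u.map φ).prod ^ n = 0 := by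
    rintro u ⟨x, hx, hcx⟩
    obtain ⟨s, t, rfl⟩ := List.append_of_mem hx
    obtain ⟨a, b, hab⟩ := hc x hcx
    obtain ⟨n, hn⟩ := nil_of_commutator m hid (s.map φ).prod a b (t.map φ).prod
    refine ⟨n, ?_⟩
    rw [← hn, ← hab]
    simp [mul_assoc]
  obtain ⟨M, hM⟩ : ∃ M : ℕ, ∀ u : List X, u.length ≤ 2 * m → (∃ x ∈ u, c x = true) →
      (u.map φ).prod ^ M = 0 := by
    have hfin := List.finite_length_le X (2 * m)
    choose! n hn using hnil
    refine ⟨hfin.toFinset.sup n, fun u hu hx => ?_⟩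
    exact pow_eq_zero_of_le (Finset.le_sup (by simpa using hu)) (hn u hx)
  obtain ⟨N, hN⟩ := comb c (2 * m) M
  refine ⟨N, fun w hw => ?_⟩
  by_contra hne
  let S : Set (List X) := {v | v.length = w.length ∧ N ≤ v.countP c ∧ (v.map φ).prod ≠ 0}
  have hS : S.Finite := (List.finite_length_eq X w.length).subset (fun v hv => hv.1)
  obtain ⟨v, hv, hmin⟩ := Set.exists_min_image S id hS ⟨w, rfl, hw, hne⟩
  have hsmall : ∀ v', v'.Perm v → v' < v → (v'.map φ).prod = 0 := by
    intro v' hp hlt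
    by_contra hne'
    exact absurd (hmin v' ⟨hp.length_eq.trans hv.1, (hp.countP_eq c) ▸ hv.2.1, hne'⟩) (not_le.2 hlt)
  apply hv.2.2
  rcases hN v hv.2.1 with ⟨r, Ws, hvr, hlen, hpw⟩ | ⟨α, u, β, hvr, hlen, hx⟩
  · have hnd : Ws.Nodup := hpw.imp (fun {a b} h => by
      rintro rfl; exact lt_irrefl _ h.lt)
    have := apply_identity m hid (fun u : List X => (u.map φ).prod) (r.map φ).prod Ws hlen hnd (by
      intro L hL hLne
      have h1 := (flatten_prec Ws L hL hpw hLne).app r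
      have h2 := hsmall (r ++ L.flatten) (by rw [hvr]; exact (hL.flatten).append_left r)
        (by rw [hvr]; exact h1.lt)
      rw [← h2]
      simp [List.map_flatten, List.prod_flatten, Function.comp_def])
    rw [← this, hvr]
    simp [List.map_flatten, List.prod_flatten, Function.comp_def]
  · have h1 := hM u hlen hx
    rw [hvr]
    simp [List.map_flatten, List.prod_flatten, h1]

theorem prod_zero {k A : Type*} [CommRing k] [Ring A] [Algebra k A] [Algebra.FiniteType k A]
    (m : ℕ) (hid : ∀ x y : A, (x * y - y * x) ^ m = 0) :
    ∃ N : ℕ, ∀ L : List (A × A), N ≤ L.length →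
      (L.map fun q => q.1 * q.2 - q.2 * q.1).prod = 0 := by
  obtain ⟨S, hS⟩ := (Algebra.FiniteType.out : (⊤ : Subalgebra k A).FG)
  let X := S ⊕ (S × S)
  let φ : X → A := Sum.elim (fun s => s.1) (fun q => q.1.1 * q.2.1 - q.2.1 * q.1.1)
  let c : X → Bool := Sum.elim (fun _ => false) (fun _ => true)
  obtain ⟨N, hN⟩ := words_zero m hid φ c (by
    rintro (s | q) h
    · simp [c] at h
    · exact ⟨q.1.1, q.2.1, rfl⟩)
  let V : ℕ → Submodule k A := fun n =>
    Submodule.span k {a | ∃ w : List X, n ≤ w.countP c ∧ (w.map φ).prod = a}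
  have hmul : ∀ i j, ∀ a ∈ V i, ∀ b ∈ V j, a * b ∈ V (i + j) := by
    intro i j a ha b hb
    have : V i * V j ≤ V (i + j) := by
      simp only [V]
      rw [Submodule.span_mul_span]
      apply Submodule.span_mono
      rintro _ ⟨_, ⟨w, hw, rfl⟩, _, ⟨w', hw', rfl⟩, rfl⟩
      exact ⟨w ++ w', by rw [List.countP_append]; omega, by simp⟩
    exact this (Submodule.mul_mem_mul ha hb)
  have hV0 : ∀ a, a ∈ V 0 := by
    intro a
    let T : Subalgebra k A := Submodule.toSubalgebra (V 0)
      (Submodule.subset_span ⟨[], by simp, by simp⟩) (fun a b ha hb => hmul 0 0 a ha b hb)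
    have hT : Algebra.adjoin k (S : Set A) ≤ T := Algebra.adjoin_le (by
      intro s hs
      exact Submodule.subset_span ⟨[Sum.inl ⟨s, hs⟩], by simp, by simp [φ]⟩)
    rw [hS] at hT
    exact hT (Algebra.mem_top : a ∈ (⊤ : Subalgebra k A))
  have hl : ∀ n a, ∀ b ∈ V n, a * b ∈ V n := fun n a b hb => by
    have := hmul 0 n a (hV0 a) b hb
    rwa [zero_add] at this
  have hr : ∀ n a, ∀ b ∈ V n, b * a ∈ V n := fun n a b hb => hmul n 0 b hb a (hV0 a)
  have hder : ∀ x : A, (∀ s ∈ S, x * s - s * x ∈ V 1) → ∀ y, x * y - y * x ∈ V 1 := by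
    intro x hx y
    have hy : y ∈ Algebra.adjoin k (S : Set A) := by rw [hS]; exact Algebra.mem_top
    induction hy using Algebra.adjoin_induction with
    | mem s hs => exact hx s hs
    | algebraMap r => rw [Algebra.commutes, sub_self]; exact zero_mem _
    | add a b _ _ ha hb =>
      have : x * (a + b) - (a + b) * x = (x * a - a * x) + (x * b - b * x) := by noncomm_ring
      rw [this]; exact add_mem ha hb
    | mul a b _ _ ha hb =>
      have : x * (a * b) - a * b * x = (x * a - a * x) * b + a * (x * b - b * x) := by noncomm_ring
      rw [this]; exact add_mem (hr _ _ _ ha) (hl _ _ _ hb)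
  have hcomm : ∀ x y : A, x * y - y * x ∈ V 1 := by
    intro x
    apply hder
    intro s hs
    have := hder s (fun t ht => Submodule.subset_span
      ⟨[Sum.inr (⟨s, hs⟩, ⟨t, ht⟩)], by simp [c], by simp [φ]⟩) x
    rw [← neg_sub]; exact neg_mem this
  have hL : ∀ L : List (A × A), (L.map fun q => q.1 * q.2 - q.2 * q.1).prod ∈ V L.length := by
    intro L
    induction L with
    | nil => exact hV0 _
    | cons q L ih =>
      rw [List.map_cons, List.prod_cons, List.length_cons, add_comm]
      exact hmul _ _ _ (hcomm _ _) _ ih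
  refine ⟨N, fun L hlen => ?_⟩
  have h0 : V L.length = ⊥ := by
    simp only [V]
    rw [Submodule.span_eq_bot]
    rintro _ ⟨w, hw, rfl⟩
    exact hN w (hlen.trans hw)
  have := hL L
  rw [h0] at this
  simpa using this

end CP

theorem commPow_implies_commProd_of_fg
    (k A : Type*) [CommRing k] [IsNoetherianRing k] [Ring A] [Algebra k A]
    [Algebra.FiniteType k A]
    (m : ℕ) (hm : 1 ≤ m) (hid : IsPolyId k A (commPow k m)) :
    ∃ m' : ℕ, 1 ≤ m' ∧ IsPolyId k A (commProd k m') := by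
  have hid' : ∀ x y : A, (x * y - y * x) ^ m = 0 := by
    intro x y
    have := hid (fun i => if i = 0 then x else y)
    simpa [commPow] using this
  obtain ⟨N, hN⟩ := CP.prod_zero (k := k) m hid'
  refine ⟨N + 1, by omega, fun f => ?_⟩
  have := hN ((List.range (N + 1)).map fun i => (f (2 * i), f (2 * i + 1))) (by simp)
  rw [← this, commProd, map_list_prod, List.map_map, List.map_map]
  congr 1
  apply List.map_congr_left
  intro i _
  simp
end

section
/- Let F be a field, let m ≥ 1, and let A be a finitely generated unital F-algebra such that [x₁,x₂]^m is a polynomial identity of A. Then the Jacobson radical of A (the intersection of all maximal left ideals of A) equals the set of nilpotent elements of A. -/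
section Helpers

/-- If `u * t = 0`, powers of `t + u` split. -/
lemma jr_add_pow {R : Type*} [Ring R] {t u : R} (h : u * t = 0) (N : ℕ) :
    (t + u) ^ (N + 1) = t * (t + u) ^ N + u ^ (N + 1) := by
  have key : ∀ N : ℕ, u * (t + u) ^ N = u ^ (N + 1) := by
    intro N
    induction N with
    | zero => simp
    | succ k ih =>
      rw [pow_succ', ← mul_assoc, mul_add, h, zero_add, mul_assoc, ih, ← pow_succ']
  rw [pow_succ', add_mul, key]

/-- A version of Levitzki's lemma: a semiprime ring has no nonzero right ideal
which is nil of bounded index. -/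
lemma jr_levitzki {R : Type*} [Ring R] (hR : ∀ x : R, (∀ y, x * y * x = 0) → x = 0)
    (n : ℕ) : ∀ b : R, (∀ x, (b * x) ^ n * b = 0) → b = 0 := by
  induction n with
  | zero => intro b hb; simpa using hb 0
  | succ n ih =>
    rcases n with _ | n
    · intro b hb
      exact hR b fun y => by simpa using hb y
    · intro b hb
      -- first step
      have h1 : ∀ x, (b * x) ^ (n + 2) = 0 := by
        intro x
        set u := b * x with hu
        apply ih
        intro y
        set t := u ^ (n + 2) * y with ht
        have hub : u ^ (n + 2) * b = 0 := hb x
        have hu3 : u ^ (n + 3) = 0 := by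
          rw [pow_succ, hu, ← mul_assoc, ← hu, hub, zero_mul]
        have hut : u * t = 0 := by
          rw [ht, ← mul_assoc, ← pow_succ', hu3, zero_mul]
        have htb : t = b * (x * u ^ (n + 1) * y) := by
          rw [ht, pow_succ' u, hu]; simp only [mul_assoc]
        have htn : t ^ (n + 2) * b = 0 := by rw [htb]; exact hb _
        have hs : t + u = b * (x * u ^ (n + 1) * y + x) := by
          rw [mul_add, ← htb, ← hu]
        have e0 : (t + u) ^ (n + 2) * b = 0 := by rw [hs]; exact hb _
        have e1 : t * (t + u) ^ (n + 1) * b = 0 := by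
          rw [jr_add_pow hut, add_mul, hub, add_zero] at e0
          exact e0
        have e2 : t ^ (n + 2) * (t + u) ^ n * b = 0 := by
          rw [hs, mul_assoc, mul_pow_mul, ← mul_assoc, htn, zero_mul]
        have e3 : t ^ (n + 1) * u ^ (n + 1) * b = 0 := by
          have : t ^ n * (t * (t + u) ^ (n + 1) * b) = 0 := by rw [e1, mul_zero]
          rw [jr_add_pow hut, mul_add, add_mul, mul_add] at this
          have e4 : t ^ n * (t * (t * (t + u) ^ n) * b) = 0 := by
            rw [← e2, pow_succ, pow_succ]; simp only [mul_assoc]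
          rw [e4, zero_add] at this
          rw [← this, pow_succ]; simp only [mul_assoc]
        calc t ^ (n + 1) * u ^ (n + 2) = t ^ (n + 1) * u ^ (n + 1) * b * x := by
              rw [pow_succ u (n + 1)]; nth_rewrite 2 [hu]; simp only [mul_assoc]
          _ = 0 := by rw [e3, zero_mul]
      -- second step
      have h2 : ∀ x, (b * x) ^ (n + 1) = 0 := by
        intro x
        set u := b * x with hu
        apply ih
        intro y
        set t := u ^ (n + 1) * y with ht
        have hu2 : u ^ (n + 2) = 0 := h1 x
        have hut : u * t = 0 := by
          rw [ht, ← mul_assoc, ← pow_succ', hu2, zero_mul]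
        have htb : t = b * (x * u ^ n * y) := by
          rw [ht, pow_succ' u, hu]; simp only [mul_assoc]
        have htn : t ^ (n + 2) = 0 := by rw [htb]; exact h1 _
        have hs : t + u = b * (x * u ^ n * y + x) := by
          rw [mul_add, ← htb, ← hu]
        have e0 : (t + u) ^ (n + 2) = 0 := by rw [hs]; exact h1 _
        rw [jr_add_pow hut, hu2, add_zero, jr_add_pow hut, mul_add] at e0
        have : t ^ n * (t * (t * (t + u) ^ n) + t * u ^ (n + 1)) = 0 := by rw [e0, mul_zero]
        have e4 : t ^ n * (t * (t * (t + u) ^ n)) = 0 := by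
          rw [← zero_mul ((t + u) ^ n), ← htn, pow_succ, pow_succ]; simp only [mul_assoc]
        rw [mul_add, e4, zero_add] at this
        rw [← this, pow_succ]; simp only [mul_assoc]
      exact ih b fun x => by rw [h2, zero_mul]

/-- A semiprime ring satisfying `[x,y]^m = 0` is reduced. -/
lemma jr_reduced {R : Type*} [Ring R] (hR : ∀ x : R, (∀ y, x * y * x = 0) → x = 0)
    (m : ℕ) (hm : ∀ x y : R, (x * y - y * x) ^ m = 0) : IsReduced R := by
  rw [isReduced_iff_pow_one_lt 2 (by norm_num)]
  intro x hx
  apply jr_levitzki hR m x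
  intro y
  have key : ∀ k : ℕ, (x * y - y * x) ^ k * x = (x * y) ^ k * x := by
    intro k
    induction k with
    | zero => simp
    | succ k ih =>
      have h1 : (x * y - y * x) * x = x * (y * x) := by
        have : y * x * x = 0 := by rw [mul_assoc, ← sq, hx, mul_zero]
        rw [sub_mul, this, sub_zero, mul_assoc]
      rw [pow_succ, mul_assoc, h1, ← mul_assoc, ih, pow_succ]
      simp only [mul_assoc]
  rw [← key, hm, zero_mul]

lemma jr_comm {R : Type*} [Ring R] [IsReduced R]
    (m : ℕ) (hm : ∀ x y : R, (x * y - y * x) ^ m = 0) (x y : R) : x * y = y * x :=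
  sub_eq_zero.mp (IsReduced.eq_zero _ ⟨m, hm x y⟩)

lemma jr_comm_jacobson (F : Type*) {R : Type*} [Field F] [Ring R] [Algebra F R]
    [Algebra.FiniteType F R] (hc : ∀ x y : R, x * y = y * x) (x : R)
    (hx : x ∈ Ring.jacobson R) : IsNilpotent x := by
  let : CommRing R := { ‹Ring R› with mul_comm := hc }
  have : IsJacobsonRing R := isJacobsonRing_of_finiteType (A := F)
  have h := Ideal.radical_eq_jacobson (⊥ : Ideal R)
  rw [Ideal.jacobson_bot] at h
  have : x ∈ (⊥ : Ideal R).radical := by rw [h]; exact hx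
  obtain ⟨n, hn⟩ := this
  exact ⟨n, by simpa using hn⟩

/-- The quotient by the Jacobson radical is semiprime. -/
lemma jr_semiprime {A : Type*} [Ring A] (x : A ⧸ Ring.jacobson A)
    (hx : ∀ y, x * y * x = 0) : x = 0 := by
  have hbot := Ring.jacobson_quotient_jacobson A
  have : x ∈ Ring.jacobson (A ⧸ Ring.jacobson A) := by
    refine Ideal.jacobson_bot.le (Ideal.mem_jacobson_iff.2 ?_)
    intro y
    refine ⟨1 - y * x, ?_⟩
    have : (1 - y * x) * y * x + (1 - y * x) - 1 = - (y * (x * y * x)) := by noncomm_ring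
    rw [this, hx]
    simp
  rw [hbot] at this
  simpa using this

lemma jr_exists_semiprime {A : Type*} [Ring A] (a : A) (ha : ¬ IsNilpotent a) :
    ∃ (P : Ideal A) (_ : P.IsTwoSided), (∀ n : ℕ, a ^ n ∉ P) ∧
      ∀ x : A ⧸ P, (∀ y, x * y * x = 0) → x = 0 := by
  let S : Set (Ideal A) := {I | I.IsTwoSided ∧ ∀ n : ℕ, a ^ n ∉ I}
  have hbot : (⊥ : Ideal A) ∈ S := by
    refine ⟨inferInstance, fun n hn => ha ⟨n, by simpa using hn⟩⟩
  obtain ⟨P, -, hP⟩ := zorn_le_nonempty₀ S (by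
    intro c hcS hc y hy
    have hmem : ∀ z, z ∈ sSup c ↔ ∃ I ∈ c, z ∈ I := fun z =>
      Submodule.mem_sSup_of_directed ⟨y, hy⟩ hc.directedOn
    refine ⟨sSup c, ⟨⟨?_⟩, ?_⟩, fun z hz => le_sSup hz⟩
    · intro z b hz
      obtain ⟨I, hI, hzI⟩ := (hmem _).1 hz
      have := (hcS hI).1
      exact (hmem _).2 ⟨I, hI, I.mul_mem_right b hzI⟩
    · intro n hn
      obtain ⟨I, hI, hzI⟩ := (hmem _).1 hn
      exact (hcS hI).2 n hzI) ⊥ hbot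
  have := hP.prop.1
  refine ⟨P, hP.prop.1, hP.prop.2, fun x hx => ?_⟩
  let K : Ideal (A ⧸ P) := Ideal.span {x} * ⊤
  have hKK : ∀ u ∈ K, ∀ v ∈ K, u * v = 0 := by
    have h0 : ∀ v ∈ K, ∀ y, x * y * v = 0 := by
      intro v hv y
      refine Submodule.mul_induction_on hv ?_ ?_
      · intro p hp q _
        obtain ⟨r, rfl⟩ := Ideal.mem_span_singleton'.1 hp
        have : x * y * (r * x * q) = x * (y * r) * x * q := by simp only [mul_assoc]
        rw [this, hx, zero_mul]
      · intro p q hp hq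
        rw [mul_add, hp, hq, add_zero]
    intro u hu v hv
    refine Submodule.mul_induction_on hu ?_ ?_
    · intro p hp q _
      obtain ⟨r, rfl⟩ := Ideal.mem_span_singleton'.1 hp
      rw [mul_assoc r, mul_assoc r, h0 v hv, mul_zero]
    · intro p q hp hq
      rw [add_mul, hp, hq, add_zero]
  have hK : K.IsTwoSided := inferInstanceAs (Ideal.span {x} * ⊤ : Ideal (A ⧸ P)).IsTwoSided
  have hxK : x ∈ K := by
    have := Ideal.mul_mem_mul (Ideal.mem_span_singleton_self x)
      (Submodule.mem_top (x := (1 : A ⧸ P)))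
    simpa using this
  let L : Ideal A := K.comap (Ideal.Quotient.mk P)
  have hPL : P ≤ L := by
    intro z hz
    show Ideal.Quotient.mk P z ∈ K
    rw [Ideal.Quotient.eq_zero_iff_mem.2 hz]
    exact K.zero_mem
  have hLS : L ∈ S := by
    refine ⟨⟨?_⟩, ?_⟩
    · intro z b hz
      show Ideal.Quotient.mk P (z * b) ∈ K
      rw [map_mul]
      exact K.mul_mem_right _ hz
    · intro n hn
      have := hKK _ hn _ hn
      rw [← map_mul, ← pow_add] at this
      exact hP.prop.2 _ (Ideal.Quotient.eq_zero_iff_mem.1 this)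
  have hLP : L ≤ P := hP.le_of_ge hLS hPL
  obtain ⟨z, rfl⟩ := Ideal.Quotient.mk_surjective x
  exact Ideal.Quotient.eq_zero_iff_mem.2 (hLP hxK)

end Helpers

theorem jacobson_radical_eq_nilpotents
    (F A : Type*) [Field F] [Ring A] [Algebra F A] [Algebra.FiniteType F A]
    (m : ℕ) (hm : 1 ≤ m) (hid : IsPolyId F A (commPow F m)) (a : A) :
    (∀ J : Ideal A, J.IsMaximal → a ∈ J) ↔ IsNilpotent a := by
  have hA : ∀ x y : A, (x * y - y * x) ^ m = 0 := by
    intro x y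
    have := hid (fun n => if n = 0 then x else y)
    simpa [commPow] using this
  have hquot : ∀ (P : Ideal A) [P.IsTwoSided], ∀ x y : A ⧸ P, (x * y - y * x) ^ m = 0 := by
    intro P _ x y
    obtain ⟨x, rfl⟩ := Ideal.Quotient.mk_surjective x
    obtain ⟨y, rfl⟩ := Ideal.Quotient.mk_surjective y
    rw [← map_mul, ← map_mul, ← map_sub, ← map_pow, hA, map_zero]
  have hJ : (∀ J : Ideal A, J.IsMaximal → a ∈ J) ↔ a ∈ Ring.jacobson A := by
    rw [Ring.jacobson_eq_sInf_isMaximal, Submodule.mem_sInf]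
    rfl
  rw [hJ]
  constructor
  · intro ha
    by_contra hn
    obtain ⟨P, hP, hPn, hsp⟩ := jr_exists_semiprime a hn
    have := jr_reduced hsp m (hquot P)
    have : Algebra.FiniteType F (A ⧸ P) :=
      Algebra.FiniteType.of_surjective (Ideal.Quotient.mkₐ F P) (Ideal.Quotient.mkₐ_surjective F P)
    have : RingHomSurjective (Ideal.Quotient.mk P) := ⟨Ideal.Quotient.mk_surjective⟩
    obtain ⟨n, h⟩ := jr_comm_jacobson F (jr_comm m (hquot P)) (Ideal.Quotient.mk P a)
      (Ring.le_comap_jacobson (Ideal.Quotient.mk P) ha)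
    rw [← map_pow] at h
    exact hPn n (Ideal.Quotient.eq_zero_iff_mem.1 h)
  · intro ha
    have := jr_reduced jr_semiprime m (hquot (Ring.jacobson A))
    exact Ideal.Quotient.eq_zero_iff_mem.1
      (IsReduced.eq_zero _ (ha.map (Ideal.Quotient.mk (Ring.jacobson A))))
end
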